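/- arXiv:1112.5942 — 3 statements merged into one kernel-verified Lean document; each statement's English description precedes it below -/
import Mathlib

section
/- Let 0 ≤ k ≤ n and let X₁, …, X_{n−k} ⊆ ℝⁿ be compact sets each of which is (n−k)-convex. Then the union over i of conv_{k+1} X_i equals the union over i of conv X_i. -/
open Finset

/-- `convComb k X`: points expressible as a convex combination of at most `k` points of `X`. -/
def convComb {n : ℕ} (k : ℕ) (X : Set (EuclideanSpace ℝ (Fin n))) :
    Set (EuclideanSpace ℝ (Fin n)) :=
  {p | ∃ (t : Fin k → ℝ) (x : Fin k → EuclideanSpace ℝ (Fin n)),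
    (∀ i, 0 ≤ t i) ∧ (∀ i, x i ∈ X) ∧ ∑ i, t i = 1 ∧ ∑ i, t i • x i = p}

open scoped RealInnerProductSpace

lemma approx_crit {E : Type*} [NormedAddCommGroup E] [InnerProductSpace ℝ E] [FiniteDimensional ℝ E]
    [Nontrivial E] (Y : Set E) (hY : IsCompact Y) (hit : ∀ u : E, u ≠ 0 → ∃ y ∈ Y, ⟪u, y⟫ = 0)
    (ε : ℝ) (hε : 0 < ε) :
    ∃ u : E, ‖u‖ = 1 ∧ ∀ w : E, ∃ y ∈ Y, |⟪u, y⟫| ≤ 2 * ε ∧ ⟪w, y⟫ - ⟪w, u⟫ * ⟪u, y⟫ ≤ 0 := by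
  obtain ⟨S, hSY, hSfin, hS⟩ := hY.finite_cover_balls hε
  obtain ⟨T, rfl⟩ := hSfin.exists_finset_coe
  set φ : ℝ → ℝ := fun t => max 0 (2 * ε - |t|) with hφ
  have hφc : Continuous φ := by fun_prop
  set h : ℝ → ℝ := fun t => ∫ x in (0:ℝ)..t, φ x with hh
  have hd : ∀ t, HasDerivAt h (φ t) t := fun t =>
    intervalIntegral.integral_hasDerivAt_right (hφc.intervalIntegrable _ _)
      (hφc.stronglyMeasurableAtFilter _ _) hφc.continuousAt
  have hc : Continuous h := continuous_iff_continuousAt.2 fun t => (hd t).continuousAt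
  set F : E → ℝ := fun u => ∑ p ∈ T, h ⟪u, p⟫ with hF
  have hFc : Continuous F := by
    apply continuous_finsetSum
    intro p _
    exact hc.comp (by fun_prop)
  obtain ⟨u, hu, hmax⟩ := (isCompact_sphere (0:E) 1).exists_isMaxOn
    (NormedSpace.sphere_nonempty.2 zero_le_one) hFc.continuousOn
  have hu1 : ‖u‖ = 1 := by simpa using hu
  have huu : ⟪u, u⟫ = 1 := by rw [real_inner_self_eq_norm_sq, hu1]; norm_num
  have hu0 : u ≠ 0 := by rintro rfl; simp at hu1
  obtain ⟨y, hy, huy⟩ := hit u hu0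
  refine ⟨u, hu1, fun w => ?_⟩
  set w' := w - ⟪w, u⟫ • u with hw'
  have hin : ∀ z, ⟪w', z⟫ = ⟪w, z⟫ - ⟪w, u⟫ * ⟪u, z⟫ := fun z => by
    rw [hw', inner_sub_left, inner_smul_left]; simp
  by_cases h0 : w' = 0
  · refine ⟨y, hy, by rw [huy]; simp; positivity, ?_⟩
    rw [← hin, h0]; simp
  by_contra! hcon
  have hn : 0 < ‖w'‖ := norm_pos_iff.2 h0
  set v := ‖w'‖⁻¹ • w' with hv
  have hvv : ⟪v, v⟫ = 1 := by
    rw [hv, inner_smul_left, inner_smul_right, real_inner_self_eq_norm_sq]; simp; field_simp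
  have huv : ⟪u, v⟫ = 0 := by
    rw [hv, inner_smul_right, real_inner_comm, hin, huu]; simp
  have hcurve : ∀ t : ℝ, ‖Real.cos t • u + Real.sin t • v‖ = 1 := by
    intro t
    have : ‖Real.cos t • u + Real.sin t • v‖ ^ 2 = 1 := by
      rw [← real_inner_self_eq_norm_sq]
      simp only [inner_add_left, inner_add_right, inner_smul_left, inner_smul_right, huu, hvv, huv,
        real_inner_comm u v]
      simp
      nlinarith [Real.sin_sq_add_cos_sq t]
    nlinarith [norm_nonneg (Real.cos t • u + Real.sin t • v)]
  have hder : HasDerivAt (fun t : ℝ => F (Real.cos t • u + Real.sin t • v))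
      (∑ p ∈ T, φ ⟪u, p⟫ * ⟪v, p⟫) 0 := by
    simp only [hF]
    apply HasDerivAt.fun_sum
    intro p _
    have h1 : HasDerivAt (fun t : ℝ => ⟪Real.cos t • u + Real.sin t • v, p⟫) ⟪v, p⟫ 0 := by
      simp only [inner_add_left, inner_smul_left]
      have := ((Real.hasDerivAt_cos 0).mul_const ⟪u, p⟫).add
        ((Real.hasDerivAt_sin 0).mul_const ⟪v, p⟫)
      simp only [Real.sin_zero, Real.cos_zero, neg_zero, zero_mul, one_mul, zero_add] at this
      exact this
    have h2 := (hd ⟪Real.cos 0 • u + Real.sin 0 • v, p⟫).comp (0:ℝ) h1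
    simp only [Real.sin_zero, Real.cos_zero, one_smul, zero_smul, add_zero] at h2
    exact h2
  have hloc : IsLocalMax (fun t : ℝ => F (Real.cos t • u + Real.sin t • v)) 0 := by
    refine Filter.Eventually.of_forall fun t => ?_
    have := hmax (show Real.cos t • u + Real.sin t • v ∈ Metric.sphere (0:E) 1 by
      simpa using hcurve t)
    simpa using this
  have hz := hloc.hasDerivAt_eq_zero hder
  have hpos : ∀ p ∈ T, 0 < φ ⟪u, p⟫ → 0 < φ ⟪u, p⟫ * ⟪v, p⟫ := by
    intro p hp hpp
    refine mul_pos hpp ?_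
    have h3 : |⟪u, p⟫| ≤ 2 * ε := by
      by_contra! h4
      simp only [hφ] at hpp
      rw [max_eq_left (by linarith)] at hpp
      exact lt_irrefl _ hpp
    have := hcon p (hSY hp) h3
    rw [← hin] at this
    rw [hv, inner_smul_left]
    simp only [conj_trivial]
    positivity
  obtain ⟨p, hp, hyp⟩ : ∃ p ∈ T, y ∈ Metric.ball p ε := by simpa using hS hy
  have h5 : 0 < φ ⟪u, p⟫ := by
    have : |⟪u, p⟫| ≤ ε := by
      have e : ⟪u, p⟫ = ⟪u, p - y⟫ := by rw [inner_sub_right, huy, sub_zero]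
      rw [e]
      calc _ ≤ ‖u‖ * ‖p - y‖ := abs_real_inner_le_norm _ _
        _ ≤ ε := by
          rw [hu1, one_mul, ← dist_eq_norm, dist_comm]; exact (Metric.mem_ball.1 hyp).le
    simp only [hφ]
    exact lt_max_of_lt_right (by linarith)
  have : 0 < ∑ p ∈ T, φ ⟪u, p⟫ * ⟪v, p⟫ := by
    apply Finset.sum_pos'
    · intro q hq
      have hq0 : 0 ≤ φ ⟪u, q⟫ := le_max_left _ _
      rcases hq0.eq_or_lt with h | h
      · rw [← h]; simp
      · exact (hpos q hq h).le
    · exact ⟨p, hp, hpos p hp h5⟩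
  linarith

/-- Caratheodory with an index type `Fin (k + 1)`. -/
lemma carath_fin {E : Type*} [AddCommGroup E] [Module ℝ E] [FiniteDimensional ℝ E]
    {s : Set E} {x : E} (hx : x ∈ convexHull ℝ s) (L : Submodule ℝ E) {k : ℕ}
    (hL : Module.finrank ℝ L ≤ k) (hsL : s ⊆ L) :
    ∃ (t : Fin (k + 1) → ℝ) (y : Fin (k + 1) → E),
      (∀ i, 0 ≤ t i) ∧ (∀ i, y i ∈ s) ∧ ∑ i, t i = 1 ∧ ∑ i, t i • y i = x := by
  obtain ⟨ι, _, z, w, hz, hind, hw, hw1, hwz⟩ := eq_pos_convex_span_of_mem_convexHull hx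
  have hne : Nonempty ι := by
    by_contra h
    rw [not_nonempty_iff] at h
    simp at hw1
  have hcard : Fintype.card ι ≤ k + 1 := by
    rw [← hind.finrank_vectorSpan_add_one]
    have hle : vectorSpan ℝ (Set.range z) ≤ L := by
      rw [vectorSpan_def, Submodule.span_le]
      rintro _ ⟨a, ha, b, hb, rfl⟩
      exact L.sub_mem (hsL (hz ha)) (hsL (hz hb))
    have := Submodule.finrank_mono hle
    omega
  obtain ⟨g⟩ : Nonempty (ι ↪ Fin (k + 1)) :=
    Function.Embedding.nonempty_of_card_le (by simpa using hcard)
  have hsum : ∀ {M : Type _} [AddCommMonoid M] (G : ι → M),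
      ∑ i, Function.extend g G 0 i = ∑ i, G i := by
    intro M _ G
    classical
    rw [← Finset.sum_subset (Finset.subset_univ (univ.map g))]
    · rw [Finset.sum_map]; simp [g.injective.extend_apply]
    · intro i _ hi
      rw [Function.extend_apply']
      · rfl
      · rintro ⟨a, rfl⟩
        simp at hi
  have hsumR : ∑ i, Function.extend g w 0 i = ∑ i, w i := by
    classical
    rw [← Finset.sum_subset (Finset.subset_univ (univ.map g))]
    · rw [Finset.sum_map]; simp [g.injective.extend_apply]
    · intro i _ hi
      rw [Function.extend_apply']
      · rfl
      · rintro ⟨a, rfl⟩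
        simp at hi
  obtain ⟨i₀⟩ := hne
  have hzX : ∀ i, z i ∈ s := fun i => hz ⟨i, rfl⟩
  refine ⟨Function.extend g w 0, Function.extend g z (fun _ => z i₀), ?_, ?_,
    by rw [hsumR, hw1], ?_⟩
  · intro i
    by_cases hi : ∃ a, g a = i
    · obtain ⟨a, rfl⟩ := hi
      rw [g.injective.extend_apply]; exact (hw a).le
    · rw [Function.extend_apply' _ _ _ hi]; simp
  · intro i
    by_cases hi : ∃ a, g a = i
    · obtain ⟨a, rfl⟩ := hi
      rw [g.injective.extend_apply]; exact hzX a
    · rw [Function.extend_apply' _ _ _ hi]; exact hzX i₀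
  · have h1 := hwz
    rw [← hsum] at h1
    refine Eq.trans (Finset.sum_congr rfl fun i _ => ?_) h1
    by_cases hi : ∃ a, g a = i
    · obtain ⟨a, rfl⟩ := hi
      simp only [g.injective.extend_apply]
    · simp only [Function.extend_apply' _ _ _ hi]; simp

lemma compact_hull {E : Type*} [NormedAddCommGroup E] [InnerProductSpace ℝ E]
    [FiniteDimensional ℝ E] {K : Set E} (hK : IsCompact K) : IsCompact (convexHull ℝ K) := by
  set d := Module.finrank ℝ E with hd
  have hc : IsCompact ((fun q : (Fin (d + 1) → ℝ) × (Fin (d + 1) → E) => ∑ i, q.1 i • q.2 i) ''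
      (stdSimplex ℝ (Fin (d + 1)) ×ˢ Set.univ.pi fun _ => K)) :=
    ((isCompact_stdSimplex ℝ _).prod (isCompact_univ_pi fun _ => hK)).image (by fun_prop)
  convert hc using 1
  apply Set.Subset.antisymm
  · intro x hx
    obtain ⟨t, y, ht, hy, h1, h2⟩ := carath_fin hx ⊤ (k := d) (by simp [hd]) (by simp)
    exact ⟨(t, y), ⟨⟨ht, h1⟩, fun i _ => hy i⟩, h2⟩
  · rintro _ ⟨⟨t, y⟩, ⟨⟨ht, h1⟩, hy⟩, rfl⟩
    exact (convex_convexHull ℝ K).sum_mem (fun j _ => ht j) h1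
      (fun j _ => subset_convexHull ℝ _ (hy j trivial))

lemma exists_crit {E : Type*} [NormedAddCommGroup E] [InnerProductSpace ℝ E] [FiniteDimensional ℝ E]
    [Nontrivial E] (Y : Set E) (hY : IsCompact Y) (hit : ∀ u : E, u ≠ 0 → ∃ y ∈ Y, ⟪u, y⟫ = 0) :
    ∃ u : E, ‖u‖ = 1 ∧ (0 : E) ∈ convexHull ℝ (Y ∩ {y | ⟪u, y⟫ = 0}) := by
  choose u hu1 hu using fun j : ℕ => approx_crit Y hY hit (1 / ((j : ℝ) + 1)) (by positivity)
  obtain ⟨a, ha, σ, hσ, hlim⟩ := (isCompact_sphere (0:E) 1).tendsto_subseq (x := u)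
    (fun j => by simpa using hu1 j)
  have ha1 : ‖a‖ = 1 := by simpa using ha
  refine ⟨a, ha1, ?_⟩
  by_contra hnot
  have hcl : IsCompact (Y ∩ {y | ⟪a, y⟫ = 0}) :=
    hY.inter_right (isClosed_eq (by fun_prop) (by fun_prop))
  obtain ⟨f, r, hf0, hf⟩ := geometric_hahn_banach_point_closed (convex_convexHull ℝ _)
    (compact_hull hcl).isClosed hnot
  set w := (InnerProductSpace.toDual ℝ E).symm f with hw
  have hwf : ∀ y, ⟪w, y⟫ = f y := fun y => by
    rw [hw, InnerProductSpace.toDual_symm_apply]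
  choose y hy hy1 hy2 using fun j => hu j w
  obtain ⟨b, hb, τ, hτ, hlim2⟩ := hY.tendsto_subseq (x := fun j => y (σ j)) (fun j => hy _)
  have hlim1 := hlim.comp hτ.tendsto_atTop
  have e0 : Filter.Tendsto (fun j => 2 * (1 / (((σ (τ j) : ℕ) : ℝ) + 1))) Filter.atTop (nhds 0) := by
    have := (tendsto_one_div_add_atTop_nhds_zero_nat (𝕜 := ℝ)).comp
      (hσ.tendsto_atTop.comp hτ.tendsto_atTop)
    simpa using this.const_mul 2
  have e1 : Filter.Tendsto (fun j => ⟪u (σ (τ j)), y (σ (τ j))⟫) Filter.atTop (nhds ⟪a, b⟫) :=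
    hlim1.inner hlim2
  have e2 : ⟪a, b⟫ = 0 := by
    have := le_of_tendsto_of_tendsto' e1.abs e0 (fun j => hy1 _)
    exact abs_nonpos_iff.1 this
  have e3 : Filter.Tendsto (fun j => ⟪w, y (σ (τ j))⟫ - ⟪w, u (σ (τ j))⟫ * ⟪u (σ (τ j)), y (σ (τ j))⟫)
      Filter.atTop (nhds (⟪w, b⟫ - ⟪w, a⟫ * ⟪a, b⟫)) :=
    (tendsto_const_nhds.inner hlim2).sub ((tendsto_const_nhds.inner hlim1).mul e1)
  have e4 := le_of_tendsto' e3 (fun j => hy2 _)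
  rw [e2, hwf] at e4
  have := hf b (subset_convexHull ℝ _ ⟨hb, e2⟩)
  simp at hf0
  linarith

lemma exists_sub (n d : ℕ) (h : d ≤ n) : ∃ V : Submodule ℝ (EuclideanSpace ℝ (Fin n)),
    Module.finrank ℝ V = d := by
  obtain ⟨b, hb⟩ := exists_linearIndependent_of_le_finrank (R := ℝ)
    (M := EuclideanSpace ℝ (Fin n)) (n := d) (by simpa using h)
  exact ⟨Submodule.span ℝ (Set.range b), by rw [finrank_span_eq_card hb]; simp⟩

lemma single {n k : ℕ} (hk : k < n) (X : Set (EuclideanSpace ℝ (Fin n)))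
    (hcpt : IsCompact X)
    (hconv : ∀ f : EuclideanSpace ℝ (Fin n) →ₗ[ℝ] EuclideanSpace ℝ (Fin (n - k)),
      Convex ℝ (f '' X)) (p : EuclideanSpace ℝ (Fin n)) (hp : p ∈ convexHull ℝ X) :
    p ∈ convComb (k + 1) X := by
  obtain ⟨V, hV⟩ := exists_sub n (k + 1) hk
  have : Fact (Module.finrank ℝ V = k + 1) := ⟨hV⟩
  have : Nontrivial V := Module.nontrivial_of_finrank_pos (R := ℝ) (by omega)
  -- every `k`-dimensional subspace through `p` meets `X`
  have key : ∀ L : Submodule ℝ (EuclideanSpace ℝ (Fin n)), Module.finrank ℝ L = k →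
      ∃ x ∈ X, x - p ∈ L := by
    intro L hL
    have hLo : Module.finrank ℝ Lᗮ = n - k := by
      have := L.finrank_add_finrank_orthogonal
      simp at this
      omega
    let e : Lᗮ ≃ₗ[ℝ] EuclideanSpace ℝ (Fin (n - k)) :=
      LinearEquiv.ofFinrankEq _ _ (by rw [hLo]; simp)
    let f : EuclideanSpace ℝ (Fin n) →ₗ[ℝ] EuclideanSpace ℝ (Fin (n - k)) :=
      e.toLinearMap ∘ₗ (Lᗮ.orthogonalProjectionOnto).toLinearMap
    have h1 : f p ∈ f '' X := by
      rw [← (hconv f).convexHull_eq, ← LinearMap.image_convexHull]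
      exact ⟨p, hp, rfl⟩
    obtain ⟨x, hx, hfx⟩ := h1
    refine ⟨x, hx, ?_⟩
    have h2 : f (x - p) = 0 := by rw [map_sub, hfx, sub_self]
    have h3 : Lᗮ.orthogonalProjectionOnto (x - p) = 0 := e.map_eq_zero_iff.1 h2
    rw [Submodule.orthogonalProjectionOnto_eq_zero_iff] at h3
    simpa using h3
  let Y : Set V := {y | (y : EuclideanSpace ℝ (Fin n)) + p ∈ X}
  have hY : IsCompact Y := by
    have hemb : Topology.IsClosedEmbedding (fun y : V => (y : EuclideanSpace ℝ (Fin n)) + p) :=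
      (Homeomorph.addRight p).isClosedEmbedding.comp
        V.closed_of_finiteDimensional.isClosedEmbedding_subtypeVal
    exact hemb.isCompact_preimage hcpt
  obtain ⟨u, hu1, hu⟩ := exists_crit Y hY (by
    intro u hu
    have hd : Module.finrank ℝ (ℝ ∙ u)ᗮ = k := Submodule.finrank_orthogonal_span_singleton hu
    obtain ⟨x, hx, y, hy, hyx⟩ := key ((ℝ ∙ u)ᗮ.map V.subtype) (by
      rw [← hd]
      exact (Submodule.equivMapOfInjective V.subtype V.injective_subtype _).finrank_eq.symm)
    refine ⟨y, ?_, Submodule.mem_orthogonal_singleton_iff_inner_right.1 hy⟩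
    simp only [Submodule.subtype_apply] at hyx
    simp only [Y, Set.mem_ofPred_eq, hyx, sub_add_cancel]
    exact hx)
  have hu0 : u ≠ 0 := by rintro rfl; simp at hu1
  obtain ⟨t, y, ht, hy, h1, h2⟩ := carath_fin hu (ℝ ∙ u)ᗮ (k := k)
    (Submodule.finrank_orthogonal_span_singleton hu0).le
    (fun y hy => Submodule.mem_orthogonal_singleton_iff_inner_right.2 hy.2)
  refine ⟨t, fun i => (y i : EuclideanSpace ℝ (Fin n)) + p, ht, fun i => (hy i).1, h1, ?_⟩
  simp only [smul_add, Finset.sum_add_distrib, ← Finset.sum_smul, h1, one_smul]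
  have := congrArg (fun y : V => (y : EuclideanSpace ℝ (Fin n))) h2
  simp at this
  rw [this, zero_add]

/-- For `n-k` compact `(n-k)`-convex sets in `ℝⁿ`, the union of the `conv_{k+1} X i`
equals the union of the `conv X i`. -/
theorem union_k_convex_caratheodory {n k : ℕ} (hk : k ≤ n)
    (X : Fin (n - k) → Set (EuclideanSpace ℝ (Fin n)))
    (hcpt : ∀ i, IsCompact (X i))
    (hconv : ∀ i, ∀ f : EuclideanSpace ℝ (Fin n) →ₗ[ℝ] EuclideanSpace ℝ (Fin (n - k)),
      Convex ℝ (f '' X i)) :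
    ⋃ i, convComb (k + 1) (X i) = ⋃ i, convexHull ℝ (X i) := by
  apply Set.Subset.antisymm
  · refine Set.iUnion_mono fun i => ?_
    rintro p ⟨t, x, ht, hx, h1, rfl⟩
    exact (convex_convexHull ℝ (X i)).sum_mem (fun j _ => ht j) h1
      (fun j _ => subset_convexHull ℝ _ (hx j))
  · refine Set.iUnion_mono fun i p hp => ?_
    have : k < n := by have := i.2; omega
    exact single this (X i) (hcpt i) (hconv i) p hp
end

section
/- Let 0 ≤ k ≤ n and let X₁, …, X_{k+1} ⊆ ℝⁿ be compact sets, each (n−k)-convex (every linear image in ℝ^{n−k} is convex). If the origin lies in conv X_i for every i, then there exist points x_i ∈ X_i and nonnegative coefficients t_i with Σ t_i = 1 such that Σ t_i x_i = 0. -/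
open Finset

namespace CC

/-- nonnegative-combination membership -/
def InPos {ι V : Type*} [Fintype ι] [AddCommGroup V] [Module ℝ V] (w : V) (y : ι → V) : Prop :=
  ∃ c : ι → ℝ, (∀ i, 0 ≤ c i) ∧ ∑ i, c i • y i = w

lemma even_facets {ι V : Type*} [Fintype ι] [DecidableEq ι] [AddCommGroup V] [Module ℝ V]
    [FiniteDimensional ℝ V] (hcard : Module.finrank ℝ V < Fintype.card ι) (w : V) (Y : ι → V)
    (G : ∀ d : ι → ℝ, ∑ i, d i • Y i = w → ∀ a b, d a = 0 → d b = 0 → a = b)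
    (N : ∀ g : ι → ℝ, (∀ i, 0 ≤ g i) → ∑ i, g i • Y i = 0 → ∀ i, g i = 0)
    (Fac : Finset ι)
    (hFac : ∀ a, a ∈ Fac ↔ ∃ d : ι → ℝ, (∀ i, 0 ≤ d i) ∧ d a = 0 ∧ ∑ i, d i • Y i = w) :
    Even Fac.card := by
  classical
  rcases Fac.eq_empty_or_nonempty with h | ⟨a, ha⟩
  · simp [h]
  obtain ⟨d, hd0, hda, hd⟩ := (hFac a).1 ha
  have hdpos : ∀ j, j ≠ a → 0 < d j := fun j hj =>
    lt_of_le_of_ne (hd0 j) (fun h => hj (G d hd j a h.symm hda))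
  -- relations vanishing at a are trivial
  have R0 : ∀ r : ι → ℝ, ∑ i, r i • Y i = 0 → r a = 0 → ∀ j, r j = 0 := by
    intro r hr hra j
    by_contra hj
    have hja : j ≠ a := by rintro rfl; exact hj hra
    apply hja
    apply G (fun i => d i - (d j / r j) * r i)
    · simp only [sub_smul, Finset.sum_sub_distrib, mul_smul, ← Finset.smul_sum, hr, hd]
      simp
    · field_simp; ring
    · simp [hda, hra]
  obtain ⟨g, hg, hg1, hga⟩ : ∃ g : ι → ℝ, ∑ i, g i • Y i = 0 ∧ (∃ i, g i ≠ 0) ∧ 0 < g a := by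
    have : ¬ LinearIndependent ℝ Y := fun h => by
      have := h.fintype_card_le_finrank
      omega
    rw [Fintype.linearIndependent_iff] at this
    push Not at this
    obtain ⟨g, hg, i, hi⟩ := this
    have hga : g a ≠ 0 := fun h => hi (R0 g hg h i)
    rcases lt_or_gt_of_ne hga with h | h
    · exact ⟨fun i => - g i, by simp [hg], ⟨i, by simpa using hi⟩, by linarith⟩
    · exact ⟨g, hg, ⟨i, hi⟩, h⟩
  have hneg : (univ.filter (fun j => g j < 0)).Nonempty := by
    by_contra h
    rw [Finset.not_nonempty_iff_eq_empty, Finset.filter_eq_empty_iff] at h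
    have := N g (fun i => not_lt.1 (h (mem_univ i))) hg a
    linarith
  obtain ⟨b, hb, hbmin⟩ := Finset.exists_min_image _ (fun j => d j / (- g j)) hneg
  simp only [Finset.mem_filter, mem_univ, true_and] at hb hbmin
  have hba : b ≠ a := by rintro rfl; linarith
  set s := d b / (- g b) with hs
  have hs0 : 0 < s := div_pos (hdpos b hba) (by linarith)
  have hsb : d b + s * g b = 0 := by
    have hb' := hb.ne
    rw [hs, div_neg]; field_simp; ring
  have hsol : ∀ s : ℝ, ∑ i, (d i + s * g i) • Y i = w := by
    intro s
    simp only [add_smul, Finset.sum_add_distrib, mul_smul, ← Finset.smul_sum, hg, hd]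
    simp
  have hbF : b ∈ Fac := by
    rw [hFac]
    refine ⟨fun i => d i + s * g i, fun i => ?_, hsb, hsol s⟩
    rcases lt_or_ge (g i) 0 with h | h
    · have := hbmin i h
      rw [le_div_iff₀ (by linarith)] at this
      change 0 ≤ d i + s * g i
      linarith
    · have := hd0 i
      positivity
  have : Fac = {a, b} := by
    ext l
    simp only [Finset.mem_insert, Finset.mem_singleton]
    constructor
    · intro hl
      by_contra hcon
      push Not at hcon
      obtain ⟨hla, hlb⟩ := hcon
      obtain ⟨d', hd'0, hd'l, hd'⟩ := (hFac l).1 hl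
      set s' := d' a / g a with hs'
      have hs'0 : 0 ≤ s' := div_nonneg (hd'0 a) hga.le
      have key : ∀ j, d' j = d j + s' * g j := by
        intro j
        have := R0 (fun i => d' i - (d i + s' * g i)) (by
          simp only [sub_smul, Finset.sum_sub_distrib, hd', hsol]; simp) (by
          simp only [hda, hs']; field_simp; ring) j
        linarith
      have h1 := key l
      rw [hd'l] at h1
      have hdl := hdpos l hla
      have hgl : g l < 0 := by
        by_contra h
        push Not at h
        have := mul_nonneg hs'0 h
        linarith
      have h2 := hbmin l hgl
      rw [le_div_iff₀ (by linarith)] at h2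
      have h3 := hd'0 b
      rw [key b] at h3
      have h4 : s' ≤ s := by
        rw [hs, le_div_iff₀ (by linarith)]; linarith
      have h5 : s ≤ s' := by
        by_contra h
        push Not at h
        nlinarith
      have h6 : s' = s := le_antisymm h4 h5
      apply hlb
      apply G d' hd' l b hd'l
      rw [key b, h6, hsb]
    · rintro (rfl | rfl)
      · exact ha
      · exact hbF
  rw [this, Finset.card_pair hba.symm]
  exact even_two

abbrev E (m : ℕ) := EuclideanSpace ℝ (Fin m)

/-- genericity of w w.r.t. a finite set -/
def Gen {m : ℕ} (S : Finset (E m)) (w : E m) : Prop :=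
  ∀ T : Finset (E m), T ⊆ S → T.card < m → w ∉ Submodule.span ℝ (T : Set (E m))

lemma Gen.mono {m : ℕ} {S S' : Finset (E m)} {w : E m} (h : Gen S' w) (hs : S ⊆ S') : Gen S w :=
  fun T hT => h T (hT.trans hs)

lemma exists_gen {m : ℕ} (S : Finset (E m)) : ∃ w, Gen S w := by
  classical
  have := Subspace.biUnion_ne_univ_of_top_notMem (k := ℝ) (E := E m)
    (s := ((S.powerset.filter (fun T => T.card < m)).image
      (fun T : Finset (E m) => Submodule.span ℝ (T : Set (E m))))) (by
      simp only [Finset.mem_image, Finset.mem_filter, Finset.mem_powerset, not_exists, not_and]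
      rintro T ⟨_, hT⟩ h
      have h1 := finrank_span_finset_le_card (R := ℝ) T
      rw [Set.finrank, h, finrank_top, finrank_euclideanSpace_fin] at h1
      omega)
  rw [Set.ne_univ_iff_exists_notMem] at this
  obtain ⟨w, hw⟩ := this
  refine ⟨w, fun T hT hc hmem => hw ?_⟩
  simp only [Set.mem_iUnion]
  exact ⟨_, Finset.mem_image.2 ⟨T, Finset.mem_filter.2 ⟨Finset.mem_powerset.2 hT, hc⟩, rfl⟩, hmem⟩

/-- a generic vector is not a combination of fewer than m of the vectors -/
lemma Gen.not_small {m : ℕ} {S : Finset (E m)} {w : E m} (h : Gen S w) {ι : Type*} [Fintype ι]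
    [DecidableEq ι]
    (Y : ι → E m) (hY : ∀ i, Y i ∈ S) (d : ι → ℝ) (hd : ∑ i, d i • Y i = w) (A : Finset ι)
    (hA : ∀ i ∈ A, d i = 0) : m + A.card ≤ Fintype.card ι := by
  classical
  by_contra hcon
  refine h ((Aᶜ).image Y) ?_ ?_ ?_
  · intro x hx
    obtain ⟨i, _, rfl⟩ := Finset.mem_image.1 hx
    exact hY i
  · refine lt_of_le_of_lt Finset.card_image_le ?_
    have := Finset.card_add_card_compl A
    omega
  · rw [← hd]
    refine Submodule.sum_mem _ fun i _ => ?_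
    by_cases hi : i ∈ A
    · simp [hA i hi]
    · refine Submodule.smul_mem _ _ (Submodule.subset_span ?_)
      simp only [Finset.coe_image]
      exact ⟨i, by simpa using hi, rfl⟩

lemma Gen.coeff_ne {m : ℕ} {S : Finset (E m)} {w : E m} (h : Gen S w)
    (y : Fin m → E m) (hy : ∀ i, y i ∈ S) (c : Fin m → ℝ) (hc : ∑ i, c i • y i = w) (i : Fin m) :
    c i ≠ 0 := fun h0 => by
  have := h.not_small y hy c hc {i} (by simpa using h0)
  simp at this

lemma Gen.indep {m : ℕ} {S : Finset (E m)} {w : E m} (h : Gen S w)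
    (y : Fin m → E m) (hy : ∀ i, y i ∈ S) (c : Fin m → ℝ) (hc : ∑ i, c i • y i = w) :
    ∀ g : Fin m → ℝ, ∑ i, g i • y i = 0 → ∀ i, g i = 0 := by
  intro g hg i
  by_contra hi
  refine h.coeff_ne y hy (fun j => c j - (c i / g i) * g j) ?_ i ?_
  · simp only [sub_smul, Finset.sum_sub_distrib, mul_smul, ← Finset.smul_sum, hg, hc]
    simp
  · field_simp; ring

open Classical in
/-- indicator mod 2 -/
noncomputable def chi {m : ℕ} (w : E m) (y : Fin m → E m) : ZMod 2 := if InPos w y then 1 else 0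

lemma exchange {m : ℕ} {S : Finset (E m)} {w : E m} (h : Gen S w)
    (y : Fin m → E m) (z : E m) (hy : ∀ i, y i ∈ S) (hz : z ∈ S)
    (N : ∀ (c : Fin m → ℝ) (d : ℝ), (∀ i, 0 ≤ c i) → 0 ≤ d → ∑ i, c i • y i + d • z = 0 →
      (∀ i, c i = 0) ∧ d = 0) :
    chi w y + ∑ i, chi w (Function.update y i z) = 0 := by
  classical
  let Y : Option (Fin m) → E m := fun o => o.elim z y
  let P : Option (Fin m) → Prop := fun a =>
    ∃ d : Option (Fin m) → ℝ, (∀ i, 0 ≤ d i) ∧ d a = 0 ∧ ∑ i, d i • Y i = w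
  have hY : ∀ a, Y a ∈ S := by rintro (_ | i); exacts [hz, hy i]
  have hE : Even (univ.filter P).card := by
    apply even_facets (by simp) w Y _ _ _ (by simp [P])
    · intro d hd a b ha hb
      by_contra hab
      have := h.not_small Y hY d hd {a, b} (by
        intro i hi
        rcases Finset.mem_insert.1 hi with rfl | hi
        · exact ha
        · rw [Finset.mem_singleton.1 hi]; exact hb)
      rw [Finset.card_pair hab] at this
      simp at this
    · intro g hg hs
      rw [Fintype.sum_option] at hs
      obtain ⟨h1, h2⟩ := N (fun i => g (some i)) (g none) (fun i => hg _) (hg _) (by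
        rw [← hs, add_comm]; rfl)
      rintro (_ | i)
      exacts [h2, h1 i]
  have e1 : chi w y = if P none then 1 else 0 := by
    unfold chi
    congr 1
    apply propext
    constructor
    · rintro ⟨c, hc, hs⟩
      refine ⟨fun o => o.elim 0 c, ?_, rfl, ?_⟩
      · rintro (_ | i); exacts [le_rfl, hc i]
      · rw [Fintype.sum_option]; simpa [Y] using hs
    · rintro ⟨d, hd, h0, hs⟩
      refine ⟨fun i => d (some i), fun i => hd _, ?_⟩
      rw [Fintype.sum_option] at hs
      simpa [Y, h0] using hs
  have e2 : ∀ i, chi w (Function.update y i z) = if P (some i) then 1 else 0 := by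
    intro i
    unfold chi
    congr 1
    apply propext
    constructor
    · rintro ⟨c, hc, hs⟩
      refine ⟨fun o => o.elim (c i) (Function.update c i 0), ?_, by simp, ?_⟩
      · rintro (_ | j)
        · exact hc i
        · by_cases hj : j = i
          · subst hj; simp
          · simpa [hj] using hc j
      · rw [Fintype.sum_option, ← hs, ← Finset.add_sum_erase _ _ (mem_univ i),
          ← Finset.add_sum_erase (a := i) _ (fun j => c j • _) (mem_univ i)]
        simp only [Option.elim, Y, Function.update_self, zero_smul, zero_add]
        congr 1
        refine Finset.sum_congr rfl fun j hj => ?_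
        have hj := Finset.ne_of_mem_erase hj
        simp [hj]
    · rintro ⟨d, hd, h0, hs⟩
      refine ⟨Function.update (fun j => d (some j)) i (d none), ?_, ?_⟩
      · intro j
        by_cases hj : j = i
        · subst hj; simpa using hd _
        · simpa [hj] using hd _
      · rw [Fintype.sum_option, ← Finset.add_sum_erase _ _ (mem_univ i)] at hs
        rw [← hs, ← Finset.add_sum_erase _ _ (mem_univ i)]
        simp only [Y, Option.elim, Function.update_self, h0, zero_smul, zero_add]
        congr 1
        refine Finset.sum_congr rfl fun j hj => ?_
        have hj := Finset.ne_of_mem_erase hj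
        simp [hj]
  rw [e1, Finset.sum_congr rfl (fun i _ => e2 i),
    ← Fintype.sum_option (fun a => if P a then (1 : ZMod 2) else 0), Finset.sum_boole]
  exact (ZMod.natCast_eq_zero_iff_even).2 hE

end CC

namespace CC

/-- An abstract colored closed pseudomanifold with antipodality, with vertices mapped to `ℝ^(k+1)`. -/
structure Cx (k : ℕ) where
  F : Type
  fin : Fintype F
  phi : Fin (k + 1) → F → F
  phi_inv : ∀ i s, phi i (phi i s) = s
  phi_ne : ∀ i s, phi i s ≠ s
  alpha : F → F
  alpha_inv : ∀ s, alpha (alpha s) = s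
  alpha_ne : ∀ s, alpha s ≠ s
  p : F → Fin (k + 1) → E (k + 1)
  p_phi : ∀ i s j, j ≠ i → p (phi i s) j = p s j
  p_alpha : ∀ s i, p (alpha s) i = - p s i

attribute [instance] Cx.fin

/-- barycentric weights -/
noncomputable def bw {k : ℕ} (i j : Fin (k + 1)) : ℝ :=
  if i ≤ j then 1 / ((k : ℝ) + 1 - (i : ℕ)) else 0

lemma den_pos {k : ℕ} (i : Fin (k + 1)) : (0 : ℝ) < (k : ℝ) + 1 - (i : ℕ) := by
  have := i.2
  have : ((i : ℕ) : ℝ) < (k : ℝ) + 1 := by exact_mod_cast this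
  linarith

lemma bw_nonneg {k : ℕ} (i j : Fin (k + 1)) : 0 ≤ bw i j := by
  unfold bw
  have := den_pos i
  split_ifs <;> positivity

lemma bw_sum {k : ℕ} (i : Fin (k + 1)) : ∑ j, bw i j = 1 := by
  unfold bw
  have := den_pos i
  rw [← Finset.sum_filter, Finset.sum_const]
  have h : (univ.filter (fun j => i ≤ j)) = Finset.Ici i := by ext; simp
  rw [h, Fin.card_Ici, nsmul_eq_mul, Nat.cast_sub i.2.le]
  push_cast
  field_simp

lemma bw_last {k : ℕ} (i : Fin (k + 1)) : 1 / ((k : ℝ) + 1) ≤ bw i (Fin.last k) := by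
  unfold bw
  have := den_pos i
  rw [if_pos (Fin.le_last i)]
  apply one_div_le_one_div_of_le this
  have : (0 : ℝ) ≤ ((i : ℕ) : ℝ) := by positivity
  linarith

/-- barycentric vertex -/
noncomputable def bary {k : ℕ} (y : Fin (k + 1) → E (k + 1)) (π : Equiv.Perm (Fin (k + 1)))
    (i : Fin (k + 1)) : E (k + 1) := ∑ j, bw i j • y (π j)

lemma bary_comb {k : ℕ} (y : Fin (k + 1) → E (k + 1)) (π : Equiv.Perm (Fin (k + 1)))
    (d : Fin (k + 1) → ℝ) :
    ∑ i, d i • bary y π i = ∑ j, (∑ i, d i * bw i (π.symm j)) • y j := by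
  unfold bary
  simp only [Finset.smul_sum, Finset.sum_smul, smul_smul]
  rw [Finset.sum_comm]
  rw [← Equiv.sum_comp π (fun j => ∑ i, (d i * bw i (π.symm j)) • y j)]
  simp

lemma bw_succ {k : ℕ} (l : Fin (k + 1)) (i : Fin k) :
    bw l i.succ = bw l i.castSucc + if l = i.succ then 1 / ((k : ℝ) + 1 - (i.succ : ℕ)) else 0 := by
  unfold bw
  by_cases h : l = i.succ
  · subst h
    have : ¬ (i.succ ≤ i.castSucc) := by simp
    simp
  · have : l ≤ i.succ ↔ l ≤ i.castSucc := by
      simp only [Fin.le_def, Fin.ext_iff] at *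
      simp at *
      omega
    simp [h, this]

lemma csum_succ {k : ℕ} (d : Fin (k + 1) → ℝ) (i : Fin k) :
    ∑ l, d l * bw l i.succ = ∑ l, d l * bw l i.castSucc
      + d i.succ * (1 / ((k : ℝ) + 1 - (i.succ : ℕ))) := by
  simp only [bw_succ, mul_add, Finset.sum_add_distrib]
  simp

lemma csum_zero {k : ℕ} (d : Fin (k + 1) → ℝ) :
    ∑ l, d l * bw l 0 = d 0 * (1 / ((k : ℝ) + 1)) := by
  rw [Finset.sum_eq_single 0]
  · simp [bw]
  · intro b _ hb
    simp [bw, hb]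
  · simp

lemma bary_chi {k : ℕ} {S : Finset (E (k + 1))} {w : E (k + 1)} (h : Gen S w)
    (y : Fin (k + 1) → E (k + 1)) (hy : ∀ i, y i ∈ S) (hb : ∀ π i, bary y π i ∈ S) :
    ∑ π, chi w (bary y π) = chi w y := by
  classical
  by_cases hw : InPos w y
  · obtain ⟨c, hc, hs⟩ := hw
    have e : ∀ π, chi w (bary y π) = if π = Tuple.sort c then 1 else 0 := by
      intro π
      unfold chi
      congr 1
      apply propext
      constructor
      · rintro ⟨d, hd, hds⟩
        have hd' : ∀ i, 0 < d i := fun i => lt_of_le_of_ne (hd i)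
          (h.coeff_ne _ (hb π) d hds i).symm
        rw [bary_comb] at hds
        have hcd : ∀ j, c j = ∑ i, d i * bw i (π.symm j) := by
          intro j
          have := h.indep y hy c hs (fun j => c j - ∑ i, d i * bw i (π.symm j)) (by
            simp only [sub_smul, Finset.sum_sub_distrib, hs, hds, sub_self]) j
          linarith
        have hm : StrictMono (c ∘ π) := by
          rw [Fin.strictMono_iff_lt_succ]
          intro i
          simp only [Function.comp, hcd, Equiv.symm_apply_apply, csum_succ]
          have := den_pos i.succ
          have := hd' i.succ
          have : 0 < d i.succ * (1 / ((k : ℝ) + 1 - (i.succ : ℕ))) := by positivity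
          linarith
        rw [Tuple.eq_sort_iff]
        refine ⟨hm.monotone, fun i j hij he => ?_⟩
        exact absurd he (hm hij).ne
      · intro hπ
        have hm : Monotone (c ∘ π) := hπ ▸ Tuple.monotone_sort c
        let d : Fin (k + 1) → ℝ := Fin.cases (((k : ℝ) + 1) * c (π 0))
          (fun i => ((k : ℝ) + 1 - (i.succ : ℕ)) * (c (π i.succ) - c (π i.castSucc)))
        refine ⟨d, ?_, ?_⟩
        · intro i
          refine Fin.cases ?_ (fun i => ?_) i
          · have := hc (π 0)
            simp only [d, Fin.cases_zero]
            positivity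
          · simp only [d, Fin.cases_succ]
            have h1 := den_pos i.succ
            have h2 : c (π i.castSucc) ≤ c (π i.succ) := hm (Fin.castSucc_lt_succ).le
            exact mul_nonneg h1.le (by linarith)
        · rw [bary_comb, ← hs]
          have key : ∀ j, ∑ i, d i * bw i j = c (π j) := by
            intro j
            induction j using Fin.induction with
            | zero =>
              rw [csum_zero]
              simp only [d, Fin.cases_zero]
              field_simp
            | succ i ih =>
              rw [csum_succ, ih]
              have h1 := den_pos i.succ
              simp only [d, Fin.cases_succ]
              field_simp
              ring
          simp [key]
    simp only [e]
    rw [Finset.sum_ite_eq' univ]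
    simp only [mem_univ, if_true]
    unfold chi
    rw [if_pos ⟨c, hc, hs⟩]
  · have e : ∀ π, chi w (bary y π) = 0 := by
      intro π
      unfold chi
      rw [if_neg]
      rintro ⟨d, hd, hds⟩
      apply hw
      rw [bary_comb] at hds
      exact ⟨_, fun j => Finset.sum_nonneg fun i _ => mul_nonneg (hd i) (bw_nonneg _ _), hds⟩
    simp only [e, Finset.sum_const_zero]
    unfold chi
    rw [if_neg hw]

lemma bary_mesh {k : ℕ} (y : Fin (k + 1) → E (k + 1)) (π : Equiv.Perm (Fin (k + 1))) (D : ℝ)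
    (hD0 : 0 ≤ D)
    (hD : ∀ a b, ‖y a - y b‖ ≤ D) (i l : Fin (k + 1)) :
    ‖bary y π i - bary y π l‖ ≤ (1 - 1 / ((k : ℝ) + 1) ^ 2) * D := by
  have e : bary y π i - bary y π l = ∑ s, ∑ t, (bw i s * bw l t) • (y (π s) - y (π t)) := by
    simp only [smul_sub, Finset.sum_sub_distrib]
    unfold bary
    congr 1
    · refine Finset.sum_congr rfl fun s _ => ?_
      rw [← Finset.sum_smul, ← Finset.mul_sum, bw_sum, mul_one]
    · rw [Finset.sum_comm]
      refine Finset.sum_congr rfl fun s _ => ?_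
      rw [← Finset.sum_smul, ← Finset.sum_mul, bw_sum, one_mul]
  rw [e]
  have hb : ∀ s t, ‖(bw i s * bw l t) • (y (π s) - y (π t))‖ ≤
      bw i s * bw l t * D - if s = Fin.last k then (if t = Fin.last k then
        bw i (Fin.last k) * bw l (Fin.last k) * D else 0) else 0 := by
    intro s t
    have h0 := mul_nonneg (bw_nonneg i s) (bw_nonneg l t)
    rw [norm_smul, Real.norm_of_nonneg h0]
    have h1 := mul_le_mul_of_nonneg_left (hD (π s) (π t)) h0
    by_cases hs : s = Fin.last k
    · by_cases ht : t = Fin.last k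
      · subst hs; subst ht; simp
      · simpa [hs, ht] using hs ▸ h1
    · simpa [hs] using h1
  calc _ ≤ ∑ s, ∑ t, ‖(bw i s * bw l t) • (y (π s) - y (π t))‖ :=
        (norm_sum_le _ _).trans (Finset.sum_le_sum fun s _ => norm_sum_le _ _)
    _ ≤ _ := Finset.sum_le_sum fun s _ => Finset.sum_le_sum fun t _ => hb s t
    _ = (1 - bw i (Fin.last k) * bw l (Fin.last k)) * D := by
        simp only [Finset.sum_sub_distrib]
        congr 1
        simp only [mul_assoc, ← Finset.mul_sum, ← Finset.sum_mul, bw_sum]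
        simp [bw_sum]
        ring
    _ ≤ _ := by
        apply mul_le_mul_of_nonneg_right _ hD0
        have h1 := bw_last i
        have h2 := bw_last l
        have h3 : 0 ≤ 1 / ((k : ℝ) + 1) := by positivity
        have := mul_le_mul h1 h2 h3 (bw_nonneg _ _)
        have e : 1 / ((k : ℝ) + 1) ^ 2 = 1 / ((k : ℝ) + 1) * (1 / ((k : ℝ) + 1)) := by
          field_simp
        rw [e]; linarith

/-- barycentric subdivision -/
noncomputable def Cx.sd {k : ℕ} (C : Cx k) : Cx k where
  F := C.F × Equiv.Perm (Fin (k + 1))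
  fin := inferInstance
  phi := Fin.cases (fun s => (C.phi (s.2 0) s.1, s.2))
    (fun i s => (s.1, s.2 * Equiv.swap i.castSucc i.succ))
  phi_inv := by
    intro i
    refine Fin.cases ?_ (fun i => ?_) i
    · intro s
      simp [C.phi_inv]
    · intro s
      simp [mul_assoc]
  phi_ne := by
    intro i
    refine Fin.cases ?_ (fun i => ?_) i
    · intro s h
      exact C.phi_ne _ _ (congrArg Prod.fst h)
    · intro s h
      have := congrArg Prod.snd h
      simp only [Fin.cases_succ, mul_eq_left] at this
      have := Equiv.swap_eq_one_iff.1 this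
      exact absurd this (Fin.castSucc_lt_succ).ne
  alpha := fun s => (C.alpha s.1, s.2)
  alpha_inv := by intro s; simp [C.alpha_inv]
  alpha_ne := by
    intro s h
    exact C.alpha_ne _ (congrArg Prod.fst h)
  p := fun s => bary (C.p s.1) s.2
  p_phi := by
    intro i
    refine Fin.cases ?_ (fun i => ?_) i
    · intro s j hj
      simp only [Fin.cases_zero]
      unfold bary
      refine Finset.sum_congr rfl fun l _ => ?_
      by_cases hl : l = 0
      · have : bw j l = 0 := by
          unfold bw
          rw [if_neg]
          rw [hl]
          simpa using hj
        simp [this]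
      · rw [C.p_phi]
        intro h
        exact hl (s.2.injective h)
    · intro s j hj
      simp only [Fin.cases_succ]
      unfold bary
      rw [← Equiv.sum_comp (Equiv.swap i.castSucc i.succ)]
      refine Finset.sum_congr rfl fun l _ => ?_
      simp only [Equiv.Perm.mul_apply, Equiv.swap_apply_self]
      congr 1
      have hb : bw j i.succ = bw j i.castSucc := by
        rw [bw_succ, if_neg hj, add_zero]
      rcases eq_or_ne l i.castSucc with rfl | h1
      · simp [hb]
      rcases eq_or_ne l i.succ with rfl | h2
      · simp [hb]
      rw [Equiv.swap_apply_of_ne_of_ne h1 h2]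
  p_alpha := by
    intro s i
    unfold bary
    simp [C.p_alpha]

/-- boundary of the crosspolytope -/
noncomputable def Cx.base (k : ℕ) : Cx k where
  F := Fin (k + 1) → Bool
  fin := inferInstance
  phi := fun i s => Function.update s i (!(s i))
  phi_inv := by intro i s; simp
  phi_ne := by
    intro i s h
    have := congrFun h i
    simp at this
  alpha := fun s i => !(s i)
  alpha_inv := by intro s; simp
  alpha_ne := by
    intro s h
    have := congrFun h 0
    simp at this
  p := fun s i => (if s i then (1 : ℝ) else -1) • EuclideanSpace.single i (1 : ℝ)
  p_phi := by
    intro i s j hj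
    simp [hj]
  p_alpha := by
    intro s i
    cases h : s i <;> simp [h]

lemma base_chi {k : ℕ} {S : Finset (E (k + 1))} {w : E (k + 1)} (h : Gen S w)
    (hS : ∀ s i, (Cx.base k).p s i ∈ S) : ∑ s, chi w ((Cx.base k).p s) = 1 := by
  classical
  let sg : (Fin (k + 1) → Bool) → Fin (k + 1) → ℝ := fun s i => if s i then (1 : ℝ) else -1
  have hsg : ∀ s i, sg s i * sg s i = 1 := by
    intro s i
    simp only [sg]
    split_ifs <;> norm_num
  have hco : ∀ (s : Fin (k + 1) → Bool) (c : Fin (k + 1) → ℝ) (j : Fin (k + 1)),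
      (∑ i, c i • (Cx.base k).p s i) j = c j * sg s j := by
    intro s c j
    have : ∀ i, (c i • (Cx.base k).p s i) j = if j = i then c i * sg s i else 0 := by
      intro i
      by_cases hj : j = i
      · subst hj
        simp only [Cx.base, sg]
        split_ifs <;> simp
      · simp only [Cx.base]
        split_ifs <;> simp [hj]
    rw [WithLp.ofLp_sum, Finset.sum_apply, Finset.sum_congr rfl (fun i _ => this i)]
    simp
  have hw : ∀ (s : Fin (k + 1) → Bool), ∑ i, (sg s i * w i) • (Cx.base k).p s i = w := by
    intro s
    ext j
    rw [hco, mul_right_comm, hsg, one_mul]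
  have hw0 : ∀ i, w i ≠ 0 := by
    intro i h0
    apply h.coeff_ne _ (hS (fun _ => true)) _ (hw _) i
    rw [h0, mul_zero]
  have e : ∀ s : Fin (k + 1) → Bool, chi w ((Cx.base k).p s) =
      if s = (fun i => decide (0 < w i)) then 1 else 0 := by
    intro s
    unfold chi
    congr 1
    apply propext
    constructor
    · rintro ⟨c, hc, hs⟩
      ext1 i
      have h1 : w i = c i * sg s i := by rw [← hs]; exact hco s c i
      have h2 := hw0 i
      have h3 := hc i
      cases hsi : s i
      · simp only [sg, hsi] at h1
        symm
        simp
        simp at h1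
        linarith
      · simp only [sg, hsi] at h1
        symm
        simp at h1 ⊢
        rw [h1] at h2 ⊢
        exact lt_of_le_of_ne h3 h2.symm
    · intro hs
      refine ⟨fun i => sg s i * w i, fun i => ?_, hw s⟩
      rw [hs]
      simp only [sg, decide_eq_true_eq]
      split_ifs with h1
      · linarith
      · linarith
  calc _ = ∑ s : Fin (k + 1) → Bool, if s = (fun i => decide (0 < w i)) then (1 : ZMod 2) else 0 :=
        Finset.sum_congr rfl fun s _ => e s
    _ = 1 := by simp

lemma exists_fine (k N : ℕ) : ∃ C : Cx k, (∀ s i, ‖C.p s i‖ ≤ 1) ∧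
    (∀ s, ∃ v : E (k + 1), ‖v‖ ^ 2 ≤ k + 1 ∧ ∀ i, inner ℝ v (C.p s i) = 1) ∧
    (∀ s i j, ‖C.p s i - C.p s j‖ ≤ (1 - 1 / ((k : ℝ) + 1) ^ 2) ^ N * 2) ∧
    ∃ S, ∀ w, Gen S w → ∑ s, chi w (C.p s) = 1 := by
  classical
  have hθ : (0 : ℝ) ≤ 1 - 1 / ((k : ℝ) + 1) ^ 2 := by
    have : (1 : ℝ) ≤ ((k : ℝ) + 1) ^ 2 := by nlinarith [(Nat.cast_nonneg k : (0 : ℝ) ≤ k)]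
    have : 1 / ((k : ℝ) + 1) ^ 2 ≤ 1 := by
      rw [div_le_one (by positivity)]; exact this
    linarith
  induction N with
  | zero =>
    have hn : ∀ s i, ‖(Cx.base k).p s i‖ ≤ 1 := by
      intro s i
      simp only [Cx.base]
      rw [norm_smul]
      split_ifs <;> simp
    refine ⟨Cx.base k, hn, ?_, ?_, ?_⟩
    · intro s
      refine ⟨WithLp.toLp 2 (fun i => if (s : Fin (k + 1) → Bool) i then (1 : ℝ) else -1), ?_, ?_⟩
      · rw [EuclideanSpace.norm_sq_eq]
        have : ∀ i, ‖(if (s : Fin (k + 1) → Bool) i then (1 : ℝ) else -1)‖ ^ 2 = 1 := by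
          intro i; split_ifs <;> simp
        simp [this]
      · intro i
        simp only [Cx.base, inner_smul_right, EuclideanSpace.inner_single_right]
        split_ifs with h <;> simp [h]
    · intro s i j
      have := norm_sub_le ((Cx.base k).p s i) ((Cx.base k).p s j)
      have := hn s i
      have := hn s j
      simp only [pow_zero]
      linarith
    · refine ⟨univ.image (fun x : (Cx.base k).F × Fin (k + 1) => (Cx.base k).p x.1 x.2), ?_⟩
      intro w hw
      exact base_chi hw fun s i => Finset.mem_image.2 ⟨(s, i), mem_univ _, rfl⟩
  | succ N ih =>
    obtain ⟨C, h1, h2, h3, S, h4⟩ := ih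
    refine ⟨C.sd, ?_, ?_, ?_, ?_⟩
    · rintro ⟨s, π⟩ i
      change ‖bary (C.p s) π i‖ ≤ 1
      unfold bary
      refine (norm_sum_le _ _).trans ?_
      rw [← bw_sum i]
      refine Finset.sum_le_sum fun j _ => ?_
      rw [norm_smul, Real.norm_of_nonneg (bw_nonneg _ _)]
      exact mul_le_of_le_one_right (bw_nonneg _ _) (h1 _ _)
    · rintro ⟨s, π⟩
      obtain ⟨v, hv, hv1⟩ := h2 s
      refine ⟨v, hv, fun i => ?_⟩
      change inner ℝ v (bary (C.p s) π i) = 1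
      unfold bary
      simp only [inner_sum, inner_smul_right, hv1, mul_one, bw_sum]
    · rintro ⟨s, π⟩ i j
      have := bary_mesh (C.p s) π _ (by positivity) (h3 s) i j
      rw [pow_succ', mul_assoc]
      exact this
    · refine ⟨S ∪ univ.image (fun x : C.F × Fin (k + 1) => C.p x.1 x.2) ∪
        univ.image (fun x : (C.F × Equiv.Perm (Fin (k + 1))) × Fin (k + 1) =>
          bary (C.p x.1.1) x.1.2 x.2), fun w hw => ?_⟩
      rw [← h4 w (hw.mono (by intro x hx; simp [hx]))]
      change ∑ s : C.F × Equiv.Perm (Fin (k + 1)), chi w (bary (C.p s.1) s.2) = _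
      have hp := Fintype.sum_prod_type
        (fun x : C.F × Equiv.Perm (Fin (k + 1)) => chi w (bary (C.p x.1) x.2))
      refine hp.trans ?_
      refine Finset.sum_congr rfl fun s _ => ?_
      refine bary_chi hw (C.p s) ?_ ?_
      · intro i
        apply Finset.mem_union_left
        apply Finset.mem_union_right
        exact Finset.mem_image.2 ⟨(s, i), mem_univ _, rfl⟩
      · intro π i
        apply Finset.mem_union_right
        exact Finset.mem_image.2 ⟨((s, π), i), mem_univ _, rfl⟩

end CC

namespace CC

lemma sum_involution_zero {F : Type} [Fintype F] (f : F → ZMod 2) (g : F → F)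
    (h1 : ∀ s, f (g s) = f s) (h2 : ∀ s, g s ≠ s) (h3 : ∀ s, g (g s) = s) : ∑ s, f s = 0 := by
  refine Finset.sum_involution (fun s _ => g s) ?_ ?_ ?_ ?_
  · intro s _
    rw [h1]
    exact CharTwo.add_self_eq_zero _
  · intro s _ _
    exact h2 s
  · intro s _
    exact mem_univ _
  · intro s _
    exact h3 s

/-- the interpolating labelling -/
noncomputable def mix {k : ℕ} (p q : Fin (k + 1) → E (k + 1)) (l : ℕ) : Fin (k + 1) → E (k + 1) :=
  fun i => if (i : ℕ) < l then p i else q i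

lemma homotopy {k : ℕ} (C : Cx k) (q : C.F → Fin (k + 1) → E (k + 1))
    (q_phi : ∀ i s j, j ≠ i → q (C.phi i s) j = q s j)
    (q_alpha : ∀ s i, q (C.alpha s) i = q s i)
    (N : ∀ s (a b : Fin (k + 1) → ℝ), (∀ i, 0 ≤ a i) → (∀ i, 0 ≤ b i) →
      ∑ i, a i • C.p s i + ∑ i, b i • q s i = 0 → (∀ i, a i = 0) ∧ (∀ i, b i = 0))
    (S : Finset (E (k + 1))) (hS : ∀ w, Gen S w → ∑ s, chi w (C.p s) = 1) : False := by
  classical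
  let S' : Finset (E (k + 1)) := S ∪ univ.image (fun x : C.F × Fin (k + 1) => C.p x.1 x.2) ∪
    univ.image (fun x : C.F × Fin (k + 1) => q x.1 x.2)
  have hpS : ∀ s i, C.p s i ∈ S' := fun s i => Finset.mem_union_left _ (Finset.mem_union_right _
    (Finset.mem_image.2 ⟨(s, i), mem_univ _, rfl⟩))
  have hqS : ∀ s i, q s i ∈ S' := fun s i => Finset.mem_union_right _
    (Finset.mem_image.2 ⟨(s, i), mem_univ _, rfl⟩)
  obtain ⟨w, hw⟩ := exists_gen S'
  have h1 := hS w (hw.mono (by intro x hx; simp [S', hx]))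
  have h0 : ∑ s, chi w (q s) = 0 := by
    apply sum_involution_zero _ C.alpha _ C.alpha_ne C.alpha_inv
    intro s
    congr 1
    ext1 i
    exact q_alpha s i
  have key : ∀ l, l ≤ k + 1 → ∑ s, chi w (mix (C.p s) (q s) l) = 0 := by
    intro l
    induction l with
    | zero =>
      intro _
      rw [← h0]
      refine Finset.sum_congr rfl fun s _ => ?_
      congr 1
    | succ l ih =>
      intro hl
      have ih := ih (by omega)
      let j : Fin (k + 1) := ⟨l, by omega⟩
      have hupd : ∀ s, Function.update (mix (C.p s) (q s) l) j (C.p s j) =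
          mix (C.p s) (q s) (l + 1) := by
        intro s
        ext1 i
        by_cases hi : i = j
        · subst hi
          simp [mix, j]
        · have : (i : ℕ) ≠ l := fun h => hi (Fin.ext h)
          rw [Function.update_of_ne hi]
          simp only [mix]
          congr 1
          apply propext
          omega
      have hex : ∀ s, chi w (mix (C.p s) (q s) l) +
          ∑ i, chi w (Function.update (mix (C.p s) (q s) l) i (C.p s j)) = 0 := by
        intro s
        apply exchange hw
        · intro i
          simp only [mix]
          split_ifs
          exacts [hpS s i, hqS s i]
        · exact hpS s j
        · intro c d hc hd hsum
          obtain ⟨ha, hb⟩ := N s (fun i => (if (i : ℕ) < l then c i else 0) + if i = j then d else 0)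
            (fun i => if (i : ℕ) < l then 0 else c i)
            (fun i => by have := hc i; split_ifs <;> simp <;> linarith)
            (fun i => by have := hc i; split_ifs <;> simp <;> linarith)
            (by
              rw [← hsum]
              simp only [add_smul, Finset.sum_add_distrib, ite_smul, zero_smul]
              rw [Finset.sum_ite_eq' univ]
              simp only [mem_univ, if_true]
              rw [add_right_comm, ← Finset.sum_add_distrib]
              congr 1
              refine Finset.sum_congr rfl fun i _ => ?_
              simp only [mix]
              split_ifs <;> simp)
          have hdj : d = 0 := by
            have := ha j
            simpa [j] using this
          refine ⟨fun i => ?_, hdj⟩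
          have h1 := ha i
          have h2 := hb i
          simp only [hdj] at h1 h2
          by_cases hi : (i : ℕ) < l
          · simpa [hi] using h1
          · simpa [hi] using h2
      have hsum : ∑ s, (chi w (mix (C.p s) (q s) l) +
          ∑ i, chi w (Function.update (mix (C.p s) (q s) l) i (C.p s j))) = 0 :=
        Finset.sum_eq_zero fun s _ => hex s
      rw [Finset.sum_add_distrib, ih, zero_add, Finset.sum_comm,
        ← Finset.add_sum_erase _ _ (mem_univ j)] at hsum
      rw [Finset.sum_eq_zero (s := univ.erase j), add_zero] at hsum
      · rw [← hsum]
        exact Finset.sum_congr rfl fun s _ => by rw [hupd]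
      · intro i hi
        have hij := Finset.ne_of_mem_erase hi
        apply sum_involution_zero _ (C.phi i) _ (C.phi_ne i) (C.phi_inv i)
        intro s
        congr 1
        rw [C.p_phi i s j hij.symm]
        ext1 a
        by_cases ha : a = i
        · subst ha; simp
        · rw [Function.update_of_ne ha, Function.update_of_ne ha]
          simp only [mix]
          rw [C.p_phi i s a ha, q_phi i s a ha]
  have := key (k + 1) le_rfl
  have e : ∑ s, chi w (mix (C.p s) (q s) (k + 1)) = 1 := by
    rw [← h1]
    refine Finset.sum_congr rfl fun s _ => ?_
    congr 1
    ext1 i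
    simp only [mix]
    rw [if_pos i.2]
  rw [e] at this
  exact one_ne_zero this

lemma exists_delta {V : Type*} [NormedAddCommGroup V] [NormedSpace ℝ V] {k : ℕ} (Y : Fin (k + 1) → Set (V)) (hcpt : ∀ i, IsCompact (Y i))
    (hne : ∀ i, (Y i).Nonempty)  :
    ∃ (x : Fin (k + 1) → V) (t : Fin (k + 1) → ℝ), (∀ i, x i ∈ Y i) ∧ (∀ i, 0 ≤ t i) ∧
      ∑ i, t i = 1 ∧ ∀ (x' : Fin (k + 1) → V) (t' : Fin (k + 1) → ℝ),
        (∀ i, x' i ∈ Y i) → (∀ i, 0 ≤ t' i) → ∑ i, t' i = 1 →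
        ‖∑ i, t i • x i‖ ≤ ‖∑ i, t' i • x' i‖ := by
  classical
  have hc : IsCompact ((Set.univ.pi Y) ×ˢ (stdSimplex ℝ (Fin (k + 1)))) :=
    (isCompact_univ_pi hcpt).prod (isCompact_stdSimplex ℝ _)
  have hn : ((Set.univ.pi Y) ×ˢ (stdSimplex ℝ (Fin (k + 1)))).Nonempty := by
    refine Set.Nonempty.prod (Set.univ_pi_nonempty_iff.2 hne) ?_
    exact ⟨_, single_mem_stdSimplex ℝ 0⟩
  obtain ⟨⟨x, t⟩, ⟨hx, ht⟩, hmin⟩ := hc.exists_isMinOn hn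
    (f := fun z : (Fin (k + 1) → V) × (Fin (k + 1) → ℝ) => ‖∑ i, z.2 i • z.1 i‖)
    (by fun_prop)
  refine ⟨x, t, fun i => hx i trivial, ht.1, ht.2, fun x' t' h1 h2 h3 => ?_⟩
  have hmem : ((x', t') : (Fin (k + 1) → V) × (Fin (k + 1) → ℝ)) ∈
      (Set.univ.pi Y) ×ˢ (stdSimplex ℝ (Fin (k + 1))) :=
    Set.mk_mem_prod (fun i _ => h1 i) ⟨h2, h3⟩
  exact isMinOn_iff.1 hmin _ hmem

theorem core {k : ℕ} (Y : Fin (k + 1) → Set (E (k + 1))) (hcpt : ∀ i, IsCompact (Y i))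
    (hit : ∀ i, ∀ u : E (k + 1), u ≠ 0 → ∃ y ∈ Y i, inner ℝ u y = 0) :
    ∃ (x : Fin (k + 1) → E (k + 1)) (t : Fin (k + 1) → ℝ),
      (∀ i, x i ∈ Y i) ∧ (∀ i, 0 ≤ t i) ∧ ∑ i, t i = 1 ∧ ∑ i, t i • x i = 0 := by
  classical
  by_contra hcon
  have hne : ∀ i, (Y i).Nonempty := fun i => by
    obtain ⟨y, hy, _⟩ := hit i (EuclideanSpace.single 0 1) (by simp)
    exact ⟨y, hy⟩
  obtain ⟨x, t, hx, ht, ht1, hmin⟩ := exists_delta Y hcpt hne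
  set δ := ‖∑ i, t i • x i‖ with hδ
  have hδ0 : 0 < δ := by
    rw [hδ, norm_pos_iff]
    intro h
    exact hcon ⟨x, t, hx, ht, ht1, h⟩
  obtain ⟨R, hR0, hR⟩ := (isCompact_iUnion hcpt).isBounded.exists_pos_norm_le
  have hR : ∀ i, ∀ y ∈ Y i, ‖y‖ ≤ R := fun i y hy => hR y (Set.mem_iUnion.2 ⟨i, hy⟩)
  -- choice of labels depending only on the hyperplane
  have hch : ∀ i (L : Submodule ℝ (E (k + 1))), ∃ y, (∃ u : E (k + 1), u ≠ 0 ∧ L = (ℝ ∙ u)ᗮ) →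
      y ∈ Y i ∧ y ∈ L := by
    intro i L
    by_cases h : ∃ u : E (k + 1), u ≠ 0 ∧ L = (ℝ ∙ u)ᗮ
    · obtain ⟨u, hu, rfl⟩ := h
      obtain ⟨y, hy, hy0⟩ := hit i u hu
      exact ⟨y, fun _ => ⟨hy, Submodule.mem_orthogonal_singleton_iff_inner_right.2 hy0⟩⟩
    · exact ⟨0, fun h' => absurd h' h⟩
  choose f hf using hch
  set m : ℝ := (k : ℝ) + 1 with hm
  have hm0 : 0 < m := by positivity
  set ε : ℝ := min (1 / (2 * m)) (δ / (4 * m * R)) with hε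
  have hε0 : 0 < ε := by
    apply lt_min <;> positivity
  obtain ⟨M, hM⟩ : ∃ M : ℕ, (1 - 1 / ((k : ℝ) + 1) ^ 2) ^ M < ε / 2 := by
    apply exists_pow_lt_of_lt_one (by positivity)
    have : 0 < 1 / ((k : ℝ) + 1) ^ 2 := by positivity
    linarith
  obtain ⟨C, hC1, hC2, hC3, S, hS⟩ := exists_fine k M
  have hmesh : ∀ s i j, ‖C.p s i - C.p s j‖ ≤ ε := fun s i j => by
    have := hC3 s i j
    linarith
  have hpn : ∀ s i, 1 / m ≤ ‖C.p s i‖ ^ 2 := by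
    intro s i
    obtain ⟨v, hv, hv1⟩ := hC2 s
    have h1 := real_inner_le_norm v (C.p s i)
    rw [hv1] at h1
    rw [div_le_iff₀ hm0]
    have h2 : 1 ≤ (‖v‖ * ‖C.p s i‖) ^ 2 := by nlinarith
    rw [mul_pow] at h2
    nlinarith [sq_nonneg ‖C.p s i‖]
  have hp0 : ∀ s i, C.p s i ≠ 0 := by
    intro s i h
    have := hpn s i
    rw [h, norm_zero] at this
    have h2 : 0 < 1 / m := by positivity
    norm_num at this
    linarith [inv_pos.2 hm0]
  let q : C.F → Fin (k + 1) → E (k + 1) := fun s i => f i (ℝ ∙ C.p s i)ᗮ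
  have hq : ∀ s i, q s i ∈ Y i ∧ inner ℝ (C.p s i) (q s i) = 0 := by
    intro s i
    obtain ⟨h1, h2⟩ := hf i _ ⟨C.p s i, hp0 s i, rfl⟩
    exact ⟨h1, Submodule.mem_orthogonal_singleton_iff_inner_right.1 h2⟩
  refine homotopy C q ?_ ?_ ?_ S hS
  · intro i s j hj
    simp only [q]
    rw [C.p_phi i s j hj]
  · intro s i
    simp only [q]
    rw [C.p_alpha, ← Set.neg_singleton, Submodule.span_neg]
  · intro s a b ha hb hsum
    have hA0 : 0 ≤ ∑ i, a i := Finset.sum_nonneg fun i _ => ha i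
    have hB0 : 0 ≤ ∑ i, b i := Finset.sum_nonneg fun i _ => hb i
    -- lower bound on the q-part
    have hB : (∑ i, b i) * δ ≤ ‖∑ i, b i • q s i‖ := by
      rcases hB0.eq_or_lt with h | h
      · rw [← h, zero_mul]; exact norm_nonneg _
      · have := hmin (q s) (fun i => b i / ∑ i, b i) (fun i => (hq s i).1)
          (fun i => div_nonneg (hb i) hB0) (by rw [← Finset.sum_div]; exact div_self h.ne')
        have e : ∑ i, (b i / ∑ i, b i) • q s i = (∑ i, b i)⁻¹ • ∑ i, b i • q s i := by
          rw [Finset.smul_sum]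
          refine Finset.sum_congr rfl fun i _ => ?_
          rw [smul_smul, div_eq_inv_mul]
        rw [e, norm_smul, Real.norm_of_nonneg (inv_nonneg.2 hB0), inv_mul_eq_div,
          le_div_iff₀ h] at this
        linarith
    have hA : ‖∑ i, a i • C.p s i‖ ≤ ∑ i, a i := by
      refine (norm_sum_le _ _).trans (Finset.sum_le_sum fun i _ => ?_)
      rw [norm_smul, Real.norm_of_nonneg (ha i)]
      exact mul_le_of_le_one_right (ha i) (hC1 s i)
    have hAB : ‖∑ i, b i • q s i‖ = ‖∑ i, a i • C.p s i‖ := by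
      rw [eq_neg_of_add_eq_zero_right hsum, norm_neg]
    -- inner product with p 0
    have hin := congrArg (fun z => inner ℝ (C.p s 0) z) hsum
    simp only [inner_add_right, inner_sum, inner_smul_right, inner_zero_right] at hin
    have hε1 : ε ≤ 1 / (2 * m) := min_le_left _ _
    have hε2 : ε ≤ δ / (4 * m * R) := min_le_right _ _
    have h1 : ∀ i, 1 / (2 * m) ≤ inner ℝ (C.p s 0) (C.p s i) := by
      intro i
      have e : inner ℝ (C.p s 0) (C.p s i) = ‖C.p s 0‖ ^ 2 + inner ℝ (C.p s 0) (C.p s i - C.p s 0) := by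
        rw [inner_sub_right, real_inner_self_eq_norm_sq]; ring
      have h2 := abs_real_inner_le_norm (C.p s 0) (C.p s i - C.p s 0)
      have h3 : ‖C.p s 0‖ * ‖C.p s i - C.p s 0‖ ≤ 1 * ε :=
        mul_le_mul (hC1 s 0) (hmesh s i 0) (norm_nonneg _) zero_le_one
      have h4 := neg_abs_le (inner ℝ (C.p s 0) (C.p s i - C.p s 0))
      have h5 := hpn s 0
      have h6 : 1 / m = 1 / (2 * m) + 1 / (2 * m) := by field_simp; norm_num
      linarith
    have h2 : ∀ i, -(ε * R) ≤ inner ℝ (C.p s 0) (q s i) := by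
      intro i
      have e : inner ℝ (C.p s 0) (q s i) = inner ℝ (C.p s 0 - C.p s i) (q s i) := by
        rw [inner_sub_left, (hq s i).2, sub_zero]
      rw [e]
      have h2 := abs_real_inner_le_norm (C.p s 0 - C.p s i) (q s i)
      have h3 : ‖C.p s 0 - C.p s i‖ * ‖q s i‖ ≤ ε * R :=
        mul_le_mul (hmesh s 0 i) (hR i _ (hq s i).1) (norm_nonneg _) hε0.le
      have h4 := neg_abs_le (inner ℝ (C.p s 0 - C.p s i) (q s i))
      linarith
    have h3 : (∑ i, a i) * (1 / (2 * m)) ≤ ∑ i, a i * inner ℝ (C.p s 0) (C.p s i) := by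
      rw [Finset.sum_mul]
      exact Finset.sum_le_sum fun i _ => mul_le_mul_of_nonneg_left (h1 i) (ha i)
    have h4 : (∑ i, b i) * (-(ε * R)) ≤ ∑ i, b i * inner ℝ (C.p s 0) (q s i) := by
      rw [Finset.sum_mul]
      exact Finset.sum_le_sum fun i _ => mul_le_mul_of_nonneg_left (h2 i) (hb i)
    have h5 : (∑ i, a i) * (1 / (2 * m)) ≤ (∑ i, b i) * (ε * R) := by linarith
    have h6 : ε * R ≤ δ / (4 * m) := by
      calc ε * R ≤ δ / (4 * m * R) * R := mul_le_mul_of_nonneg_right hε2 hR0.le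
        _ = δ / (4 * m) := by field_simp
    have h7 : (∑ i, a i) * (1 / (2 * m)) ≤ (∑ i, b i) * (δ / (4 * m)) :=
      h5.trans (mul_le_mul_of_nonneg_left h6 hB0)
    have h8 : (∑ i, a i) ≤ (∑ i, b i) * δ / 2 := by
      have := mul_le_mul_of_nonneg_right h7 (by positivity : 0 ≤ 2 * m)
      have e1 : (∑ i, a i) * (1 / (2 * m)) * (2 * m) = ∑ i, a i := by field_simp
      have e2 : (∑ i, b i) * (δ / (4 * m)) * (2 * m) = (∑ i, b i) * δ / 2 := by field_simp; norm_num
      linarith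
    have h9 : (∑ i, b i) * δ ≤ 0 := by linarith
    have hBz : ∑ i, b i = 0 := by
      apply le_antisymm _ hB0
      by_contra h
      push Not at h
      have := mul_pos h hδ0
      linarith
    have hAz : ∑ i, a i = 0 := by
      rw [hBz] at h8
      simp at h8
      exact le_antisymm h8 hA0
    constructor
    · intro i
      exact (Finset.sum_eq_zero_iff_of_nonneg fun i _ => ha i).1 hAz i (mem_univ i)
    · intro i
      exact (Finset.sum_eq_zero_iff_of_nonneg fun i _ => hb i).1 hBz i (mem_univ i)

end CC

namespace CC

theorem barany {n : ℕ} (X : Fin (n + 1) → Set (E n)) (hcpt : ∀ i, IsCompact (X i))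
    (h0 : ∀ i, (0 : E n) ∈ convexHull ℝ (X i)) :
    ∃ (x : Fin (n + 1) → E n) (t : Fin (n + 1) → ℝ),
      (∀ i, x i ∈ X i) ∧ (∀ i, 0 ≤ t i) ∧ ∑ i, t i = 1 ∧ ∑ i, t i • x i = 0 := by
  classical
  have hne : ∀ i, (X i).Nonempty := fun i => convexHull_nonempty_iff.1 ⟨0, h0 i⟩
  obtain ⟨x, t, hx, ht, ht1, hmin⟩ := exists_delta X hcpt hne
  by_contra hcon
  set p := ∑ i, t i • x i with hp
  have hp0 : p ≠ 0 := fun h => hcon ⟨x, t, hx, ht, ht1, by rw [← hp]; exact h⟩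
  have hpn : 0 < ‖p‖ := norm_pos_iff.2 hp0
  -- a minimizer with a vanishing coefficient
  have step1 : ∀ (t : Fin (n + 1) → ℝ) (j : Fin (n + 1)), (∀ i, 0 ≤ t i) → ∑ i, t i = 1 →
      ∑ i, t i • x i = p → t j = 0 → False := by
    intro t j ht ht1 htp htj
    obtain ⟨y, hy, hyp⟩ : ∃ y ∈ X j, inner ℝ p y ≤ 0 := by
      by_contra h
      push Not at h
      have hsub : convexHull ℝ (X j) ⊆ {z | 0 < inner ℝ p z} := by
        apply convexHull_min
        · intro z hz; exact h z hz
        · exact convex_halfSpace_gt (f := fun z => inner ℝ p z)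
            ⟨fun a b => inner_add_right _ _ _, fun c a => by simp [inner_smul_right]⟩ 0
      have := hsub (h0 j)
      simp at this
    set l : ℝ := ‖p‖ ^ 2 / (‖y‖ ^ 2 + ‖p‖ ^ 2) with hl
    have hden : 0 < ‖y‖ ^ 2 + ‖p‖ ^ 2 := by positivity
    have hl0 : 0 < l := by positivity
    have hl1 : l ≤ 1 := by
      rw [hl, div_le_one hden]
      nlinarith [sq_nonneg ‖y‖]
    have hle : l * (‖y‖ ^ 2 + ‖p‖ ^ 2) = ‖p‖ ^ 2 := by rw [hl]; field_simp
    have h1 := hmin (Function.update x j y) (fun i => (1 - l) * t i + if i = j then l else 0)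
      (by
        intro i
        by_cases hi : i = j
        · subst hi; simpa using hy
        · simpa [hi] using hx i)
      (by
        intro i
        have := mul_nonneg (by linarith : 0 ≤ 1 - l) (ht i)
        split_ifs <;> linarith)
      (by
        rw [Finset.sum_add_distrib, ← Finset.mul_sum, ht1]; simp)
    have e : ∑ i, ((1 - l) * t i + if i = j then l else 0) • Function.update x j y i
        = (1 - l) • p + l • y := by
      rw [← htp]
      simp only [add_smul, Finset.sum_add_distrib, mul_smul, ← Finset.smul_sum, ite_smul, zero_smul]
      rw [Finset.sum_ite_eq' univ]
      simp only [mem_univ, if_true, Function.update_self]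
      congr 2
      refine Finset.sum_congr rfl fun i _ => ?_
      by_cases hi : i = j
      · subst hi; simp [htj]
      · simp [hi]
    rw [e] at h1
    have h2 : ‖p‖ ^ 2 ≤ ‖(1 - l) • p + l • y‖ ^ 2 := pow_le_pow_left₀ (norm_nonneg _) h1 2
    rw [norm_add_sq_real, norm_smul, norm_smul, inner_smul_left, inner_smul_right,
      Real.norm_of_nonneg hl0.le, Real.norm_of_nonneg (by linarith : 0 ≤ 1 - l)] at h2
    simp only [conj_trivial] at h2
    have h3 : (1 - l) * (l * inner ℝ p y) ≤ 0 :=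
      mul_nonpos_of_nonneg_of_nonpos (by linarith) (mul_nonpos_of_nonneg_of_nonpos hl0.le hyp)
    have h4 : ‖p‖ ^ 2 ≤ (1 - l) ^ 2 * ‖p‖ ^ 2 + l ^ 2 * ‖y‖ ^ 2 := by nlinarith
    have h5 : (1 - l) ^ 2 * ‖p‖ ^ 2 + l ^ 2 * ‖y‖ ^ 2
        = ‖p‖ ^ 2 - 2 * l * ‖p‖ ^ 2 + l * (l * (‖y‖ ^ 2 + ‖p‖ ^ 2)) := by ring
    rw [h5, hle] at h4
    have : 0 < l * ‖p‖ ^ 2 := by positivity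
    linarith
  have htpos : ∀ i, 0 < t i := fun i => lt_of_le_of_ne (ht i)
    (fun h => step1 t i ht ht1 hp.symm h.symm)
  obtain ⟨g, hg, ⟨a, hga⟩, hgc⟩ : ∃ g : Fin (n + 1) → ℝ, ∑ i, g i • x i = 0 ∧ (∃ i, g i ≠ 0) ∧
      0 ≤ ∑ i, g i := by
    have : ¬ LinearIndependent ℝ x := fun h => by
      have := h.fintype_card_le_finrank
      simp at this
    rw [Fintype.linearIndependent_iff] at this
    push Not at this
    obtain ⟨g, hg, i, hi⟩ := this
    rcases le_total 0 (∑ i, g i) with h | h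
    · exact ⟨g, hg, ⟨i, hi⟩, h⟩
    · exact ⟨fun i => - g i, by simp [hg], ⟨i, by simpa using hi⟩, by simpa using h⟩
  -- moving along g keeps the value
  have hval : ∀ s : ℝ, ∑ i, (t i + s * g i) • x i = p := by
    intro s
    simp only [add_smul, Finset.sum_add_distrib, mul_smul, ← Finset.smul_sum, hg]
    simp [hp]
  have hpos : ∀ s : ℝ, 0 < s → (∀ i, 0 ≤ t i + s * g i) → ∑ i, g i = 0 := by
    intro s hs hnn
    by_contra hc
    have hc : 0 < ∑ i, g i := lt_of_le_of_ne hgc (Ne.symm hc)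
    have hsum : ∑ i, (t i + s * g i) = 1 + s * ∑ i, g i := by
      rw [Finset.sum_add_distrib, ht1, Finset.mul_sum]
    set c := 1 + s * ∑ i, g i with hcdef
    have hc1 : 1 < c := by
      have := mul_pos hs hc
      linarith
    have h1 := hmin x (fun i => c⁻¹ * (t i + s * g i)) hx
      (fun i => mul_nonneg (inv_nonneg.2 (by linarith)) (hnn i))
      (by rw [← Finset.mul_sum, hsum]; exact inv_mul_cancel₀ (by linarith))
    simp only [mul_smul, ← Finset.smul_sum] at h1
    rw [hval, norm_smul, Real.norm_of_nonneg (inv_nonneg.2 (by linarith))] at h1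
    have h2 : c⁻¹ < 1 := inv_lt_one_of_one_lt₀ hc1
    nlinarith
  by_cases hneg : (univ.filter (fun j => g j < 0)).Nonempty
  · obtain ⟨b, hb, hbmin⟩ := Finset.exists_min_image _ (fun j => t j / (- g j)) hneg
    simp only [Finset.mem_filter, mem_univ, true_and] at hb hbmin
    set s := t b / (- g b) with hs
    have hs0 : 0 < s := div_pos (htpos b) (by linarith)
    have hsb : t b + s * g b = 0 := by
      have hb' := hb.ne
      rw [hs, div_neg]; field_simp; ring
    have hnn : ∀ i, 0 ≤ t i + s * g i := by
      intro i
      rcases lt_or_ge (g i) 0 with h | h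
      · have := hbmin i h
        rw [le_div_iff₀ (by linarith)] at this
        linarith
      · have := ht i
        positivity
    have hc := hpos s hs0 hnn
    refine step1 (fun i => t i + s * g i) b hnn ?_ (hval s) hsb
    rw [Finset.sum_add_distrib, ht1, ← Finset.mul_sum, hc, mul_zero, add_zero]
  · rw [Finset.not_nonempty_iff_eq_empty, Finset.filter_eq_empty_iff] at hneg
    have hgn : ∀ i, 0 ≤ g i := fun i => not_lt.1 (hneg (mem_univ i))
    have hc := hpos 1 one_pos (fun i => by have := ht i; have := hgn i; linarith)
    exact hga ((Finset.sum_eq_zero_iff_of_nonneg fun i _ => hgn i).1 hc a (mem_univ a))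

lemma exists_inj {m n : ℕ} (h : m ≤ n) : ∃ f : E m →ₗ[ℝ] E n, Function.Injective f := by
  exact finrank_le_iff_exists_linearMap.1 (by simpa using h)

theorem lower {n k : ℕ} (hk : k < n)
    (X : Fin (k + 1) → Set (E n)) (hcpt : ∀ i, IsCompact (X i))
    (hconv : ∀ i, ∀ f : E n →ₗ[ℝ] E (n - k), Convex ℝ (f '' X i))
    (h0 : ∀ i, (0 : E n) ∈ convexHull ℝ (X i)) :
    ∃ (x : Fin (k + 1) → E n) (t : Fin (k + 1) → ℝ),
      (∀ i, x i ∈ X i) ∧ (∀ i, 0 ≤ t i) ∧ ∑ i, t i = 1 ∧ ∑ i, t i • x i = 0 := by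
  obtain ⟨f, hf⟩ := exists_inj (m := k + 1) (n := n) hk
  have hemb := LinearMap.isClosedEmbedding_of_injective (f := f) (LinearMap.ker_eq_bot.2 hf)
  obtain ⟨y, t, hy, ht, ht1, hs⟩ := core (fun i => f ⁻¹' X i)
    (fun i => hemb.isCompact_preimage (hcpt i)) (by
      intro i u hu
      let L : Submodule ℝ (E n) := (ℝ ∙ u)ᗮ.map f
      have : Fact (Module.finrank ℝ (E (k + 1)) = k + 1) := ⟨by simp⟩
      have h1 : Module.finrank ℝ L = k := by
        have := Submodule.finrank_orthogonal_span_singleton (𝕜 := ℝ) (n := k) hu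
        rw [← this]
        exact ((ℝ ∙ u)ᗮ.equivMapOfInjective f hf).finrank_eq.symm
      have h2 : Module.finrank ℝ (E n ⧸ L) = Module.finrank ℝ (E (n - k)) := by
        have := L.finrank_quotient_add_finrank
        rw [h1, finrank_euclideanSpace_fin] at this
        rw [finrank_euclideanSpace_fin]
        omega
      let e := LinearEquiv.ofFinrankEq _ _ h2
      let g : E n →ₗ[ℝ] E (n - k) := e.toLinearMap ∘ₗ L.mkQ
      have h3 : (0 : E (n - k)) ∈ g '' X i := by
        rw [← (hconv i g).convexHull_eq, ← g.image_convexHull]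
        exact ⟨0, h0 i, map_zero g⟩
      obtain ⟨z, hz, hgz⟩ := h3
      have hzL : z ∈ L := by
        have : e (L.mkQ z) = 0 := hgz
        rw [e.map_eq_zero_iff] at this
        simpa using this
      obtain ⟨v, hv, rfl⟩ := hzL
      exact ⟨v, hz, Submodule.mem_orthogonal_singleton_iff_inner_right.1 hv⟩)
  refine ⟨fun i => f (y i), t, hy, ht, ht1, ?_⟩
  have := congrArg f hs
  simpa using this

end CC

/-- Colorful Carathéodory for `(n-k)`-convex sets: `k+1` colors suffice. -/
theorem colorful_caratheodory_k_convex {n k : ℕ} (hk : k ≤ n)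
    (X : Fin (k + 1) → Set (EuclideanSpace ℝ (Fin n)))
    (hcpt : ∀ i, IsCompact (X i))
    (hconv : ∀ i, ∀ f : EuclideanSpace ℝ (Fin n) →ₗ[ℝ] EuclideanSpace ℝ (Fin (n - k)),
      Convex ℝ (f '' X i))
    (h0 : ∀ i, (0 : EuclideanSpace ℝ (Fin n)) ∈ convexHull ℝ (X i)) :
    ∃ (x : Fin (k + 1) → EuclideanSpace ℝ (Fin n)) (t : Fin (k + 1) → ℝ),
      (∀ i, x i ∈ X i) ∧ (∀ i, 0 ≤ t i) ∧ ∑ i, t i = 1 ∧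
      ∑ i, t i • x i = (0 : EuclideanSpace ℝ (Fin n)) := by
  rcases hk.eq_or_lt with rfl | h
  · exact CC.barany X hcpt h0
  · exact CC.lower h X hcpt hconv h0
end

section
/- Let B be the closed unit ball in ℝⁿ and let f₁, …, f_{n+1} : B → (nonempty closed subsets of B) be set-valued maps whose graphs are closed in B × B. Then there exists x ∈ B such that x lies in the geometric join f₁(x) * ⋯ * f_{n+1}(x), i.e., x = Σ t_i y_i for some y_i ∈ f_i(x), t_i ≥ 0, Σ t_i = 1. -/
open Finset Metric

/-- `det (1 + t A)` at `t = 1` is a fixed affine combination of its values at given nodes. -/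
lemma det_interp {n : ℕ} (s : Finset ℝ) (hs : n < s.card)
    (A : EuclideanSpace ℝ (Fin n) →L[ℝ] EuclideanSpace ℝ (Fin n)) :
    (ContinuousLinearMap.id ℝ _ + (1:ℝ) • A).det =
      ∑ i ∈ s, (ContinuousLinearMap.id ℝ _ + i • A).det *
        (Lagrange.basis s (id : ℝ → ℝ) i).eval 1 := by
  classical
  let b := (EuclideanSpace.basisFun (Fin n) ℝ).toBasis
  let M := LinearMap.toMatrix b b A.toLinearMap
  let p : Polynomial ℝ := ((Polynomial.X : Polynomial ℝ) • M.map Polynomial.C +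
    (1 : Matrix (Fin n) (Fin n) ℝ).map Polynomial.C).det
  have hp : ∀ t : ℝ, p.eval t = (ContinuousLinearMap.id ℝ _ + t • A).det := by
    intro t
    have h1 : (ContinuousLinearMap.id ℝ _ + t • A).det =
        (LinearMap.toMatrix b b (LinearMap.id + t • A.toLinearMap)).det := by
      rw [LinearMap.det_toMatrix]; rfl
    rw [h1]
    simp only [p]
    rw [← Polynomial.coe_evalRingHom, RingHom.map_det]
    congr 1
    rw [map_add (LinearMap.toMatrix b b), map_smul (LinearMap.toMatrix b b), LinearMap.toMatrix_id]
    ext i j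
    by_cases hij : i = j <;> simp [M, hij, add_comm] <;> exact mul_comm _ _
  have hdeg : p.degree < s.card := by
    refine lt_of_le_of_lt Polynomial.degree_le_natDegree ?_
    have := Polynomial.natDegree_det_X_add_C_le M (1 : Matrix (Fin n) (Fin n) ℝ)
    rw [Fintype.card_fin] at this
    exact_mod_cast lt_of_le_of_lt this hs
  have h := Lagrange.eq_interpolate (v := (id : ℝ → ℝ)) (Set.injOn_id _) hdeg
  rw [← hp 1]
  conv_lhs => rw [h]
  rw [Lagrange.interpolate_apply, Polynomial.eval_finsetSum]
  simp [hp]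

lemma interp_one (s : Finset ℝ) (hs : s.Nonempty) :
    ∑ i ∈ s, (Lagrange.basis s (id : ℝ → ℝ) i).eval 1 = 1 := by
  rw [← Polynomial.eval_finsetSum, Lagrange.sum_basis (Set.injOn_id _) hs]; simp

lemma inj_of_norm {n : ℕ} {A : EuclideanSpace ℝ (Fin n) →L[ℝ] EuclideanSpace ℝ (Fin n)}
    {t C : ℝ} (hA : ‖A‖ ≤ C) (ht : 0 ≤ t) (htC : t * C < 1) :
    0 < (ContinuousLinearMap.id ℝ _ + t • A).det := by
  have hne : ∀ s ∈ Set.Icc 0 t, (ContinuousLinearMap.id ℝ _ + s • A).det ≠ 0 := by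
    intro s hs h0
    obtain ⟨v, hv, hv0⟩ := (LinearMap.bot_lt_ker_of_det_eq_zero h0 : ⊥ < LinearMap.ker _) |>
      (Submodule.exists_mem_ne_zero_of_ne_bot ∘ ne_of_gt)
    have hv1 : v + s • A v = 0 := by simpa using hv
    have h2 : ‖v‖ = s * ‖A v‖ := by
      rw [eq_neg_of_add_eq_zero_left hv1, norm_neg, norm_smul, Real.norm_of_nonneg hs.1]
      simp [← eq_neg_of_add_eq_zero_left hv1]
    have h3 : ‖A v‖ ≤ C * ‖v‖ := (A.le_opNorm v).trans (by gcongr)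
    have hvp : 0 < ‖v‖ := norm_pos_iff.2 hv0
    have h4 : s * ‖A v‖ ≤ t * (C * ‖v‖) := by
      gcongr
      · exact hs.2
    nlinarith
  have hc : Continuous fun s : ℝ => (ContinuousLinearMap.id ℝ _ + s • A).det := by
    refine ContinuousLinearMap.continuous_det.comp ?_
    fun_prop
  by_contra hcon
  have := intermediate_value_Icc' ht hc.continuousOn
  have h1 : (ContinuousLinearMap.id ℝ (EuclideanSpace ℝ (Fin n)) + (0:ℝ) • A).det = 1 := by
    simp [ContinuousLinearMap.det]
  obtain ⟨s, hs, h⟩ := this ⟨not_lt.1 hcon, by simp only [h1]; norm_num⟩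
  exact hne s hs h

open MeasureTheory in
lemma no_retraction {n : ℕ} (r : EuclideanSpace ℝ (Fin n) → EuclideanSpace ℝ (Fin n))
    (hr : ∀ x ∈ closedBall (0 : EuclideanSpace ℝ (Fin n)) 1, ContDiffAt ℝ 1 r x)
    (hn : ∀ x ∈ closedBall (0 : EuclideanSpace ℝ (Fin n)) 1, ‖r x‖ = 1)
    (hS : ∀ x, ‖x‖ = 1 → r x = x) : False := by
  set B := closedBall (0 : EuclideanSpace ℝ (Fin n)) 1
  set U := ball (0 : EuclideanSpace ℝ (Fin n)) 1
  have hUB : U ⊆ B := ball_subset_closedBall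
  have hBc : IsCompact B := isCompact_closedBall _ _
  let g : EuclideanSpace ℝ (Fin n) → EuclideanSpace ℝ (Fin n) := fun x => r x - x
  have hg : ∀ x ∈ B, ContDiffAt ℝ 1 g x := fun x hx => (hr x hx).sub contDiffAt_id
  obtain ⟨C, hC⟩ : ∃ C, LipschitzOnWith C g B := by
    apply LocallyLipschitzOn.exists_lipschitzOnWith_of_compact hBc
    intro x hx
    obtain ⟨K, s, hs, hl⟩ := (hg x hx).exists_lipschitzOnWith
    exact ⟨K, s, mem_nhdsWithin_of_mem_nhds hs, hl⟩
  have hA : ∀ x ∈ U, ‖fderiv ℝ g x‖ ≤ C := fun x hx =>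
    norm_fderiv_le_of_lipschitzOn ℝ (Filter.mem_of_superset (isOpen_ball.mem_nhds hx) hUB) hC
  have hgc : ContinuousOn (fderiv ℝ g) B := fun x hx =>
    (((hg x hx).fderiv_right (m := 0) (by simp)).continuousAt).continuousWithinAt
  have hdetc : ∀ t : ℝ, IntegrableOn
      (fun x => (ContinuousLinearMap.id ℝ _ + t • fderiv ℝ g x).det) U := by
    intro t
    refine IntegrableOn.mono_set (ContinuousOn.integrableOn_compact hBc ?_) hUB
    refine ContinuousLinearMap.continuous_det.comp_continuousOn ?_
    exact continuousOn_const.add (hgc.const_smul t)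
  have key : ∀ t : ℝ, 0 < t → t < 1 → t * C < 1 →
      ∫ x in U, (ContinuousLinearMap.id ℝ _ + t • fderiv ℝ g x).det = volume.real U := by
    intro t ht ht1 htC
    let F : EuclideanSpace ℝ (Fin n) → EuclideanSpace ℝ (Fin n) := fun x => x + t • g x
    have hFd : ∀ x ∈ B, HasStrictFDerivAt F
        (ContinuousLinearMap.id ℝ _ + t • fderiv ℝ g x) x := fun x hx =>
      (hasStrictFDerivAt_id x).add (((hg x hx).hasStrictFDerivAt (by simp)).const_smul t)
    have hFB : Set.MapsTo F B B := by
      intro x hx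
      have : F x = (1 - t) • x + t • r x := by simp only [F, g]; module
      rw [this]
      refine convex_closedBall _ _ hx ?_ (by linarith) ht.le (by ring)
      simp [hn x hx]
    have hinj : Set.InjOn F B := by
      intro x hx y hy hxy
      by_contra hne
      have h1 : x - y = t • (g y - g x) := by
        have : x + t • g x = y + t • g y := hxy
        rw [smul_sub]
        rw [← sub_eq_zero] at this ⊢
        rw [← this]; abel
      have h2 : ‖g y - g x‖ ≤ C * ‖y - x‖ := hC.norm_sub_le hy hx
      have h3 : ‖x - y‖ = t * ‖g y - g x‖ := by
        rw [h1, norm_smul, Real.norm_of_nonneg ht.le]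
      have h4 : 0 < ‖x - y‖ := norm_pos_iff.2 (sub_ne_zero.2 hne)
      rw [norm_sub_rev y x] at h2
      nlinarith
    have hpos : ∀ x ∈ U, 0 < (ContinuousLinearMap.id ℝ _ + t • fderiv ℝ g x).det :=
      fun x hx => inj_of_norm (hA x hx) ht.le htC
    have hopen : IsOpen (Set.image F U) := by
      rw [isOpen_iff_mem_nhds]
      rintro _ ⟨x, hx, rfl⟩
      have hsurj : (ContinuousLinearMap.id ℝ _ + t • fderiv ℝ g x).range = ⊤ := by
        have := LinearMap.range_eq_top.2 
          (LinearMap.equivOfDetNeZero _ (hpos x hx).ne').surjective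
        exact this
      rw [← (hFd x (hUB hx)).map_nhds_eq_of_surj hsurj]
      exact Filter.image_mem_map (isOpen_ball.mem_nhds hx)
    have hUF : (Set.image F U) ⊆ U := by
      have := interior_maximal ((Set.image_mono hUB).trans hFB.image_subset) hopen
      rwa [interior_closedBall _ (one_ne_zero)] at this
    have himg : (Set.image F U) = U := by
      apply Set.Subset.antisymm hUF
      · refine (convex_ball _ _).isPreconnected.subset_of_closure_inter_subset hopen ?_ ?_
        · rw [Set.inter_eq_self_of_subset_right hUF]
          exact ⟨F 0, 0, by simp [U], rfl⟩
        · rintro y ⟨hy, hyU⟩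
          have hcl : IsClosed (Set.image F B) := (hBc.image_of_continuousOn
            (fun x hx => (hFd x hx).continuousAt.continuousWithinAt)).isClosed
          obtain ⟨x, hx, rfl⟩ := closure_minimal (Set.image_mono hUB) hcl hy
          by_cases hxU : x ∈ U
          · exact ⟨x, hxU, rfl⟩
          · exfalso
            have hx1 : ‖x‖ = 1 := by
              simp [B, U] at hx hxU; linarith
            have : F x = x := by simp [F, g, hS x hx1]
            rw [this] at hyU
            exact hxU hyU
    have h := integral_image_eq_integral_abs_det_fderiv_smul volume (s := U) (f := F)
      measurableSet_ball (fun x hx => (hFd x (hUB hx)).hasFDerivAt.hasFDerivWithinAt)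
      (hinj.mono hUB) (fun _ => (1:ℝ))
    rw [himg] at h
    rw [setIntegral_const] at h
    simp only [smul_eq_mul, mul_one] at h
    rw [h]
    refine setIntegral_congr_fun measurableSet_ball fun x hx => ?_
    exact (abs_of_pos (hpos x hx)).symm
  have hδ : ∃ δ : ℝ, 0 < δ ∧ δ < 1 ∧ δ * C < 1 := by
    refine ⟨1 / (C + 2), by positivity, ?_, ?_⟩
    · rw [div_lt_one (by positivity)]; have := C.2; simp at this; linarith [C.coe_nonneg]
    · rw [div_mul_eq_mul_div, div_lt_one (by positivity)]; linarith
  obtain ⟨δ, hδ0, hδ1, hδC⟩ := hδ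
  obtain ⟨s, hsub, hscard⟩ := (Set.Ioo_infinite hδ0).exists_subset_card_eq (n + 1)
  have hzero : ∀ x ∈ U, (ContinuousLinearMap.id ℝ _ + (1:ℝ) • fderiv ℝ g x).det = 0 := by
    intro x hx
    have hrx := (hr x (hUB hx)).differentiableAt (by simp)
    have hid : ContinuousLinearMap.id ℝ _ + (1:ℝ) • fderiv ℝ g x = fderiv ℝ r x := by
      have : fderiv ℝ g x = fderiv ℝ r x - ContinuousLinearMap.id ℝ _ := by
        simp only [g]
        rw [fderiv_fun_sub hrx differentiableAt_fun_id]; simp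
      rw [this]; simp
    rw [hid]
    by_contra hne
    obtain ⟨v, hv⟩ := (LinearMap.equivOfDetNeZero _ hne).surjective (r x)
    have hv' : fderiv ℝ r x v = r x := hv
    have hd : HasFDerivAt (fun y => inner ℝ (r y) (r y))
      _ x := hrx.hasFDerivAt.inner ℝ hrx.hasFDerivAt
    have hd2 : HasFDerivAt (fun y => inner ℝ (r y) (r y)) 
        (0 : EuclideanSpace ℝ (Fin n) →L[ℝ] ℝ) x := by
      refine (hasFDerivAt_const (1:ℝ) x).congr_of_eventuallyEq ?_
      filter_upwards [isOpen_ball.mem_nhds hx] with y hy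
      rw [real_inner_self_eq_norm_sq, hn y (hUB hy)]; norm_num
    have := congrArg (fun L => L v) (hd.unique hd2)
    simp [hv', hn x (hUB hx)] at this
  have h1 : ∫ x in U, (ContinuousLinearMap.id ℝ _ + (1:ℝ) • fderiv ℝ g x).det = volume.real U := by
    simp_rw [det_interp s (show n < s.card by omega)]
    rw [integral_finsetSum _ (fun i _ => (hdetc i).mul_const _)]
    simp_rw [integral_mul_const]
    rw [Finset.sum_congr rfl (fun i hi => by
      have hi' := hsub hi
      rw [key i hi'.1 (hi'.2.trans hδ1)
        (lt_of_le_of_lt (mul_le_mul_of_nonneg_right hi'.2.le C.2) hδC)])]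
    rw [← Finset.mul_sum, interp_one s (Finset.card_pos.1 (by omega)), mul_one]
  rw [setIntegral_congr_fun measurableSet_ball hzero] at h1
  simp only [integral_zero] at h1
  have hp : 0 < volume.real U := by
    refine ENNReal.toReal_pos (measure_ball_pos _ _ one_pos).ne' measure_ball_lt_top.ne
  linarith

/-- Brouwer's fixed point theorem for `C¹` self-maps of the closed unit ball. -/
lemma brouwer_C1 {n : ℕ} (g : EuclideanSpace ℝ (Fin n) → EuclideanSpace ℝ (Fin n))
    (hg : ∀ x ∈ closedBall (0 : EuclideanSpace ℝ (Fin n)) 1, ContDiffAt ℝ 1 g x)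
    (hm : ∀ x ∈ closedBall (0 : EuclideanSpace ℝ (Fin n)) 1, ‖g x‖ ≤ 1) :
    ∃ x ∈ closedBall (0 : EuclideanSpace ℝ (Fin n)) 1, g x = x := by
  by_contra! hcon
  let u : EuclideanSpace ℝ (Fin n) → EuclideanSpace ℝ (Fin n) := fun x => x - g x
  have hu0 : ∀ x ∈ closedBall (0 : EuclideanSpace ℝ (Fin n)) 1, 0 < ‖u x‖ ^ 2 := fun x hx =>
    pow_pos (norm_pos_iff.2 (sub_ne_zero.2 (hcon x hx).symm)) 2
  have huc : ∀ x ∈ closedBall (0 : EuclideanSpace ℝ (Fin n)) 1, ContDiffAt ℝ 1 u x :=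
    fun x hx => contDiffAt_id.sub (hg x hx)
  have hSpos : ∀ x : EuclideanSpace ℝ (Fin n), ‖x‖ = 1 → 0 < inner ℝ x (u x) := by
    intro x hx
    have hxB : x ∈ closedBall (0 : EuclideanSpace ℝ (Fin n)) 1 := by simp [hx]
    have h1 := hu0 x hxB
    have h2 := hm x hxB
    have h3 : ‖g x‖ ^ 2 = ‖x‖ ^ 2 - 2 * inner ℝ x (u x) + ‖u x‖ ^ 2 := by
      rw [← norm_sub_sq_real]; simp [u]
    rw [hx] at h3
    nlinarith [norm_nonneg (g x)]
  let d : EuclideanSpace ℝ (Fin n) → ℝ := fun x =>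
    (inner ℝ x (u x)) ^ 2 + ‖u x‖ ^ 2 * (1 - ‖x‖ ^ 2)
  have hd : ∀ x ∈ closedBall (0 : EuclideanSpace ℝ (Fin n)) 1, 0 < d x := by
    intro x hx
    have hx1 : ‖x‖ ≤ 1 := by simpa using hx
    rcases hx1.lt_or_eq with h | h
    · have : 0 < 1 - ‖x‖ ^ 2 := by nlinarith [norm_nonneg x]
      have := mul_pos (hu0 x hx) this
      simp only [d]; positivity
    · have := hSpos x h
      simp only [d, h]; nlinarith
  let l : EuclideanSpace ℝ (Fin n) → ℝ := fun x =>
    (Real.sqrt (d x) - inner ℝ x (u x)) / ‖u x‖ ^ 2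
  refine no_retraction (fun x => x + l x • u x) ?_ ?_ ?_
  · intro x hx
    have h1 := huc x hx
    have hi : ContDiffAt ℝ 1 (fun x => (inner ℝ x (u x) : ℝ)) x := contDiffAt_id.inner ℝ h1
    have hdc : ContDiffAt ℝ 1 d x :=
      (hi.pow 2).add ((h1.norm_sq ℝ).mul (contDiffAt_const.sub (contDiffAt_id.norm_sq ℝ)))
    have hl : ContDiffAt ℝ 1 l x :=
      ((hdc.sqrt (hd x hx).ne').sub hi).div (h1.norm_sq ℝ) (hu0 x hx).ne'
    exact contDiffAt_id.add (hl.smul h1)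
  · intro x hx
    have h1 : l x * ‖u x‖ ^ 2 + inner ℝ x (u x) = Real.sqrt (d x) := by
      simp only [l]; rw [div_mul_cancel₀ _ (hu0 x hx).ne']; ring
    have h2 := Real.sq_sqrt (hd x hx).le
    rw [← h1] at h2
    have h3 : ‖x + l x • u x‖ ^ 2 = 1 := by
      rw [norm_add_sq_real, inner_smul_right, norm_smul, mul_pow, Real.norm_eq_abs, sq_abs]
      have h4 := hu0 x hx
      apply mul_left_cancel₀ h4.ne'
      simp only [d] at h2
      linear_combination h2
    exact (pow_eq_one_iff_of_nonneg (norm_nonneg _) two_ne_zero).1 h3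
  · intro x hx
    have h1 := hSpos x hx
    have : l x = 0 := by simp [l, d, hx, Real.sqrt_sq h1.le]
    simp [this]

/-- A smooth bump function that is positive exactly on `(0, 1)`. -/
noncomputable def cbump (s : ℝ) : ℝ := expNegInvGlue s * expNegInvGlue (1 - s)

lemma cbump_nonneg (s : ℝ) : 0 ≤ cbump s :=
  mul_nonneg (expNegInvGlue.nonneg _) (expNegInvGlue.nonneg _)

lemma cbump_ne_zero {s : ℝ} : cbump s ≠ 0 ↔ 0 < s ∧ s < 1 := by
  simp [cbump, not_or]

lemma cbump_contDiff : ContDiff ℝ 1 cbump := by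
  have h : ContDiff ℝ 1 expNegInvGlue := expNegInvGlue.contDiff (n := 1)
  exact h.mul (h.comp (contDiff_const.sub contDiff_id))

/-- The bump function of the cube of colour `i` with index `m`. -/
noncomputable def cphi {n : ℕ} (N : ℝ) (i : Fin (n + 1)) (m : Fin n → ℤ)
    (x : EuclideanSpace ℝ (Fin n)) : ℝ :=
  ∏ k, cbump (N * x k - (i : ℝ) / (n + 1) - m k)

lemma cphi_ne_zero {n : ℕ} {N : ℝ} {i : Fin (n + 1)} {m : Fin n → ℤ}
    {x : EuclideanSpace ℝ (Fin n)} : cphi N i m x ≠ 0 ↔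
      ∀ k, 0 < N * x k - (i : ℝ) / (n + 1) - m k ∧ N * x k - (i : ℝ) / (n + 1) - m k < 1 := by
  simp only [cphi, Finset.prod_ne_zero_iff, cbump_ne_zero, Finset.mem_univ, true_imp_iff]

lemma cphi_nonneg {n : ℕ} (N : ℝ) (i : Fin (n + 1)) (m : Fin n → ℤ)
    (x : EuclideanSpace ℝ (Fin n)) : 0 ≤ cphi N i m x :=
  Finset.prod_nonneg fun _ _ => cbump_nonneg _

lemma cphi_contDiff {n : ℕ} (N : ℝ) (i : Fin (n + 1)) (m : Fin n → ℤ) :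
    ContDiff ℝ 1 (cphi N i m) := by
  unfold cphi
  refine contDiff_prod fun k _ => cbump_contDiff.comp ?_
  fun_prop

lemma cphi_floor {n : ℕ} {N : ℝ} {i : Fin (n + 1)} {m : Fin n → ℤ}
    {x : EuclideanSpace ℝ (Fin n)} (h : cphi N i m x ≠ 0) :
    m = fun k => ⌊N * x k - (i : ℝ) / (n + 1)⌋ := by
  funext k
  have := cphi_ne_zero.1 h k
  symm
  rw [Int.floor_eq_iff]
  constructor <;> linarith [this.1, this.2]

lemma cphi_dist {n : ℕ} {N ε : ℝ} (hN : 0 < N) (hε : 0 < ε) (hNε : (n + 1 : ℝ) ≤ N * ε)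
    {i : Fin (n + 1)} {m : Fin n → ℤ}
    {x v : EuclideanSpace ℝ (Fin n)} (hx : cphi N i m x ≠ 0) (hv : cphi N i m v ≠ 0) :
    dist v x ≤ ε := by
  rw [EuclideanSpace.dist_eq]
  apply Real.sqrt_le_iff.2 ⟨hε.le, ?_⟩
  have hk : ∀ k, dist (v k) (x k) ^ 2 ≤ (1 / N) ^ 2 := by
    intro k
    have h1 := cphi_ne_zero.1 hx k
    have h2 := cphi_ne_zero.1 hv k
    have h3 : dist (v k) (x k) ≤ 1 / N := by
      rw [Real.dist_eq, le_div_iff₀ hN, ← abs_of_pos hN, ← abs_mul, abs_le]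
      constructor <;> nlinarith [h1.1, h1.2, h2.1, h2.2]
    gcongr
  calc ∑ k, dist (v k) (x k) ^ 2 ≤ ∑ _k : Fin n, (1 / N) ^ 2 := Finset.sum_le_sum fun k _ => hk k
    _ = n / N ^ 2 := by simp; ring
    _ ≤ ε ^ 2 := by
      rw [div_le_iff₀ (by positivity)]
      have : (0:ℝ) ≤ n := by positivity
      nlinarith [mul_self_le_mul_self (by positivity) hNε]

lemma cphi_exists {n : ℕ} (N : ℝ) (x : EuclideanSpace ℝ (Fin n)) :
    ∃ i : Fin (n + 1), cphi N i (fun k => ⌊N * x k - (i : ℝ) / (n + 1)⌋) x ≠ 0 := by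
  by_contra! hcon
  have h : ∀ i : Fin (n + 1), ∃ k, ∃ a : ℤ, N * x k - (i : ℝ) / (n + 1) = a := by
    intro i
    by_contra! hne
    refine cphi_ne_zero.2 (fun k => ⟨?_, ?_⟩) (hcon i)
    · have h1 := Int.floor_le (N * x k - (i : ℝ) / (n + 1))
      have h2 := hne k ⌊N * x k - (i : ℝ) / (n + 1)⌋
      exact sub_pos.2 (lt_of_le_of_ne h1 h2.symm)
    · linarith [Int.lt_floor_add_one (N * x k - (i : ℝ) / (n + 1))]
  choose k a ha using h
  obtain ⟨i, j, hij, hk⟩ := Fintype.exists_ne_map_eq_of_card_lt k (by simp)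
  have h1 := ha i
  have h2 := ha j
  rw [hk] at h1
  have hn : (0:ℝ) < n + 1 := by positivity
  have h3 : ((j : ℝ) - i) = (a i - a j) * (n + 1) := by
    rw [← h1, ← h2]; field_simp; ring
  have h4 : ((j : ℕ) : ℤ) - (i : ℕ) = (a i - a j) * (n + 1) := by exact_mod_cast h3
  have hi := i.2
  have hj := j.2
  have h5 : a i - a j = 0 := by
    rcases lt_trichotomy (a i - a j) 0 with h | h | h
    · have : (a i - a j) * ((n:ℤ) + 1) ≤ -1 * (n + 1) := by
        apply mul_le_mul_of_nonneg_right <;> omega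
      omega
    · exact h
    · have : 1 * ((n:ℤ) + 1) ≤ (a i - a j) * (n + 1) := by
        apply mul_le_mul_of_nonneg_right <;> omega
      omega
  rw [h5] at h4
  exact hij (Fin.ext (by omega))

lemma colorful_approx {n : ℕ}
    (f : Fin (n + 1) → EuclideanSpace ℝ (Fin n) → Set (EuclideanSpace ℝ (Fin n)))
    (hne : ∀ i, ∀ x ∈ closedBall (0 : EuclideanSpace ℝ (Fin n)) 1, (f i x).Nonempty)
    (hsub : ∀ i, ∀ x ∈ closedBall (0 : EuclideanSpace ℝ (Fin n)) 1,
      f i x ⊆ closedBall (0 : EuclideanSpace ℝ (Fin n)) 1) (ε : ℝ) (hε : 0 < ε) :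
    ∃ x ∈ closedBall (0 : EuclideanSpace ℝ (Fin n)) 1,
      ∃ (v y : Fin (n + 1) → EuclideanSpace ℝ (Fin n)) (t : Fin (n + 1) → ℝ),
        (∀ i, v i ∈ closedBall (0 : EuclideanSpace ℝ (Fin n)) 1) ∧ (∀ i, dist (v i) x ≤ ε) ∧
        (∀ i, y i ∈ f i (v i)) ∧ (∀ i, 0 ≤ t i) ∧ ∑ i, t i = 1 ∧ ∑ i, t i • y i = x := by
  classical
  set B := closedBall (0 : EuclideanSpace ℝ (Fin n)) 1 with hB
  obtain ⟨N, hN, hNε⟩ : ∃ N : ℝ, 0 < N ∧ (n + 1 : ℝ) ≤ N * ε :=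
    ⟨(n + 1) / ε, by positivity, by rw [div_mul_cancel₀ _ hε.ne']⟩
  have hV : ∀ (i : Fin (n + 1)) (m : Fin n → ℤ), ∃ v ∈ B,
      ((∃ x ∈ B, cphi N i m x ≠ 0) → cphi N i m v ≠ 0) := by
    intro i m
    by_cases h : ∃ x ∈ B, cphi N i m x ≠ 0
    · obtain ⟨x, hx, hx'⟩ := h
      exact ⟨x, hx, fun _ => hx'⟩
    · exact ⟨0, by simp [hB], fun h' => absurd h' h⟩
  choose V hVB hV using hV
  have hY : ∀ i m, ∃ y, y ∈ f i (V i m) := fun i m => hne i _ (hVB i m)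
  choose Y hY using hY
  have hYn : ∀ i m, ‖Y i m‖ ≤ 1 := fun i m => by
    simpa [hB] using hsub i _ (hVB i m) (hY i m)
  let K : ℤ := ⌈N⌉ + 2
  let T : Finset (Fin n → ℤ) := Fintype.piFinset fun _ => Finset.Icc (-K) K
  let τ : Fin (n + 1) → EuclideanSpace ℝ (Fin n) → ℝ := fun i x => ∑ m ∈ T, cphi N i m x
  let D : EuclideanSpace ℝ (Fin n) → ℝ := fun x => ∑ i, τ i x
  have hτ0 : ∀ i x, 0 ≤ τ i x := fun i x => Finset.sum_nonneg fun m _ => cphi_nonneg _ _ _ _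
  have hDpos : ∀ x ∈ B, 0 < D x := by
    intro x hx
    obtain ⟨i, hi⟩ := cphi_exists N x
    refine Finset.sum_pos' (fun i _ => hτ0 i x) ⟨i, Finset.mem_univ _, ?_⟩
    refine Finset.sum_pos' (fun m _ => cphi_nonneg _ _ _ _) ⟨_, ?_,
      lt_of_le_of_ne (cphi_nonneg _ _ _ _) hi.symm⟩
    rw [Fintype.mem_piFinset]
    intro k
    have hx1 : ‖x‖ ≤ 1 := by simpa [hB] using hx
    have hxk : |x k| ≤ 1 := by
      have := PiLp.norm_apply_le x k
      rw [Real.norm_eq_abs] at this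
      exact this.trans hx1
    have hxk' := abs_le.1 hxk
    have hi0 : (0:ℝ) ≤ (i : ℝ) / (n + 1) := by positivity
    have hi1 : (i : ℝ) / (n + 1) ≤ 1 := by
      rw [div_le_one (by positivity)]
      have := i.2
      exact_mod_cast this.le
    have hc := Int.le_ceil N
    rw [Finset.mem_Icc]
    constructor
    · rw [Int.le_floor]
      simp only [K]; push_cast
      nlinarith [hxk'.1, hxk'.2]
    · have h := Int.floor_le (N * x k - (i : ℝ) / (n + 1))
      have : ((⌊N * x k - (i : ℝ) / (n + 1)⌋ : ℤ) : ℝ) ≤ (K : ℝ) := by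
        simp only [K]; push_cast
        nlinarith [hxk'.1, hxk'.2]
      exact_mod_cast this
  let G : EuclideanSpace ℝ (Fin n) → EuclideanSpace ℝ (Fin n) := fun x =>
    (D x)⁻¹ • ∑ i, ∑ m ∈ T, cphi N i m x • Y i m
  obtain ⟨x, hx, hGx⟩ : ∃ x ∈ B, G x = x := by
    apply brouwer_C1
    · intro x hx
      have hDc : ContDiff ℝ 1 D :=
        ContDiff.sum fun i _ => ContDiff.sum fun m _ => cphi_contDiff N i m
      refine (hDc.contDiffAt.inv (hDpos x hx).ne').smul (ContDiff.contDiffAt ?_)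
      exact ContDiff.sum fun i _ => ContDiff.sum fun m _ =>
        (cphi_contDiff N i m).smul contDiff_const
    · intro x hx
      have hD := hDpos x hx
      simp only [G]
      rw [norm_smul, norm_inv, Real.norm_of_nonneg hD.le, inv_mul_le_iff₀ hD, mul_one]
      refine (norm_sum_le _ _).trans (Finset.sum_le_sum fun i _ => ?_)
      refine (norm_sum_le _ _).trans (Finset.sum_le_sum fun m _ => ?_)
      rw [norm_smul, Real.norm_of_nonneg (cphi_nonneg _ _ _ _)]
      exact mul_le_of_le_one_right (cphi_nonneg _ _ _ _) (hYn i m)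
  have hD := hDpos x hx
  let μ : Fin (n + 1) → Fin n → ℤ := fun i k => ⌊N * x k - (i : ℝ) / (n + 1)⌋
  have hsum : ∀ i, ∑ m ∈ T, cphi N i m x • Y i m = τ i x • Y i (μ i) := by
    intro i
    simp only [τ]
    rw [Finset.sum_smul]
    refine Finset.sum_congr rfl fun m _ => ?_
    by_cases h : cphi N i m x = 0
    · simp [h]
    · rw [cphi_floor h]
  have hμ : ∀ i, τ i x ≠ 0 → cphi N i (μ i) x ≠ 0 := by
    intro i hi
    obtain ⟨m, _, hm⟩ := Finset.exists_ne_zero_of_sum_ne_zero hi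
    have := cphi_floor hm
    rw [this] at hm
    exact hm
  choose z hz using fun i => hne i x hx
  refine ⟨x, hx, fun i => if τ i x = 0 then x else V i (μ i),
    fun i => if τ i x = 0 then z i else Y i (μ i), fun i => (D x)⁻¹ * τ i x, ?_, ?_, ?_, ?_, ?_, ?_⟩
  · intro i
    dsimp only
    split_ifs
    · exact hx
    · exact hVB _ _
  · intro i
    dsimp only
    split_ifs with h
    · simpa using hε.le
    · exact cphi_dist hN hε hNε (hμ i h) (hV i (μ i) ⟨x, hx, hμ i h⟩)
  · intro i
    dsimp only
    split_ifs
    · exact hz i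
    · exact hY _ _
  · intro i
    exact mul_nonneg (inv_nonneg.2 hD.le) (hτ0 i x)
  · rw [← Finset.mul_sum]
    exact inv_mul_cancel₀ hD.ne'
  · conv_rhs => rw [← hGx]
    simp only [G]
    rw [Finset.smul_sum]
    refine Finset.sum_congr rfl fun i _ => ?_
    rw [hsum i, mul_smul]
    split_ifs with h
    · simp [h]
    · rfl


/-- Colorful fixed-point theorem: if `f 1, …, f (n+1)` are set-valued maps from the closed
unit ball `B ⊆ ℝⁿ` to nonempty subsets of `B` with closed graphs, then some `x ∈ B` lies in
the geometric join `f 1 x * ⋯ * f (n+1) x`. -/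
theorem colorful_fixed_point {n : ℕ}
    (f : Fin (n + 1) → EuclideanSpace ℝ (Fin n) → Set (EuclideanSpace ℝ (Fin n)))
    (hne : ∀ i, ∀ x ∈ closedBall (0 : EuclideanSpace ℝ (Fin n)) 1, (f i x).Nonempty)
    (hsub : ∀ i, ∀ x ∈ closedBall (0 : EuclideanSpace ℝ (Fin n)) 1,
      f i x ⊆ closedBall (0 : EuclideanSpace ℝ (Fin n)) 1)
    (hgraph : ∀ i, IsClosed {p : EuclideanSpace ℝ (Fin n) × EuclideanSpace ℝ (Fin n) |
      p.1 ∈ closedBall (0 : EuclideanSpace ℝ (Fin n)) 1 ∧ p.2 ∈ f i p.1}) :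
    ∃ x ∈ closedBall (0 : EuclideanSpace ℝ (Fin n)) 1,
      ∃ (y : Fin (n + 1) → EuclideanSpace ℝ (Fin n)) (t : Fin (n + 1) → ℝ),
        (∀ i, y i ∈ f i x) ∧ (∀ i, 0 ≤ t i) ∧ ∑ i, t i = 1 ∧ ∑ i, t i • y i = x := by
  have hε : ∀ j : ℕ, (0:ℝ) < 1 / ((j:ℝ) + 1) := fun j => by positivity
  choose x hx v y t hv hvx hy ht ht1 hty using
    fun j : ℕ => colorful_approx f hne hsub (1 / ((j:ℝ) + 1)) (hε j)
  have hcomp : IsCompact (closedBall (0 : EuclideanSpace ℝ (Fin n)) 1 ×ˢ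
      ((Set.univ.pi fun _ : Fin (n + 1) => closedBall (0 : EuclideanSpace ℝ (Fin n)) 1) ×ˢ
        stdSimplex ℝ (Fin (n + 1)))) :=
    (isCompact_closedBall _ _).prod
      ((isCompact_univ_pi fun _ => isCompact_closedBall _ _).prod (isCompact_stdSimplex ℝ _))
  obtain ⟨⟨x₀, y₀, t₀⟩, ⟨hx₀, -, ht₀⟩, φ, hφ, hlim⟩ := hcomp.tendsto_subseq
    (x := fun j => (x j, y j, t j))
    (fun j => ⟨hx j, fun i _ => hsub i _ (hv j i) (hy j i), ht j, ht1 j⟩)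
  have hlx : Filter.Tendsto (fun j => x (φ j)) Filter.atTop (nhds x₀) :=
    (continuous_fst.tendsto _).comp hlim
  have hly : Filter.Tendsto (fun j => y (φ j)) Filter.atTop (nhds y₀) :=
    ((continuous_fst.comp continuous_snd).tendsto _).comp hlim
  have hlt : Filter.Tendsto (fun j => t (φ j)) Filter.atTop (nhds t₀) :=
    ((continuous_snd.comp continuous_snd).tendsto _).comp hlim
  have hlyi := fun i => (tendsto_pi_nhds.1 hly) i
  have hlti := fun i => (tendsto_pi_nhds.1 hlt) i
  refine ⟨x₀, hx₀, y₀, t₀, fun i => ?_, ht₀.1, ht₀.2, ?_⟩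
  · have hlv : Filter.Tendsto (fun j => v (φ j) i) Filter.atTop (nhds x₀) := by
      have h0 : Filter.Tendsto (fun j => dist (x (φ j)) (v (φ j) i)) Filter.atTop (nhds 0) := by
        refine squeeze_zero (fun _ => dist_nonneg) (fun j => ?_)
          (tendsto_one_div_add_atTop_nhds_zero_nat.comp hφ.tendsto_atTop)
        rw [dist_comm]
        exact hvx (φ j) i
      exact (tendsto_iff_of_dist h0).1 hlx
    exact ((hgraph i).mem_of_tendsto (hlv.prodMk_nhds (hlyi i))
      (Filter.Eventually.of_forall fun j => ⟨hv (φ j) i, hy (φ j) i⟩)).2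
  · have h1 : Filter.Tendsto (fun j => ∑ i, t (φ j) i • y (φ j) i) Filter.atTop
        (nhds (∑ i, t₀ i • y₀ i)) :=
      tendsto_finsetSum _ fun i _ => (hlti i).smul (hlyi i)
    simp only [hty] at h1
    exact tendsto_nhds_unique h1 hlx
end
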